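/- arXiv:2307.12669 — 3 statements merged into one kernel-verified Lean document; each statement's English description precedes it below -/
import Mathlib

section
/- Let n ≥ 2, let K be a field, let B_n be the graph obtained from the ladder graph A_n by adjoining one new vertex y_{n+1} together with the edge {y_n, y_{n+1}}, and let S = K[V(B_n)]. Then depth(S/I(B_n)) = sdepth(S/I(B_n)) = ⌈(n+1)/2⌉. -/
open MvPolynomial

/-- The edge ideal of a simple graph `G`, inside `K[x_v : v ∈ V]`. -/
noncomputable def edgeIdeal (K : Type*) [Field K] {V : Type*} (G : SimpleGraph V) :
    Ideal (MvPolynomial V K) :=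
  Ideal.span {m | ∃ i j : V, G.Adj i j ∧ m = X i * X j}

/-- The graded maximal ideal of `K[x_v : v ∈ V]`. -/
noncomputable def maxIdeal (K : Type*) [Field K] (V : Type*) : Ideal (MvPolynomial V K) :=
  Ideal.span (Set.range (X : V → MvPolynomial V K))

/-- depth of `S/I` over `S = K[x_v]`: the supremum of lengths of regular sequences on `S/I`
consisting of elements of the graded maximal ideal. -/
noncomputable def depthQuot {K : Type*} [Field K] {V : Type*} (I : Ideal (MvPolynomial V K)) : ℕ :=
  sSup {n : ℕ | ∃ rs : List (MvPolynomial V K), rs.length = n ∧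
    (∀ r ∈ rs, r ∈ maxIdeal K V) ∧
    RingTheory.Sequence.IsRegular (MvPolynomial V K ⧸ I) rs}

/-- The Stanley space `u·K[Z]` inside `S/I`, as a `K`-subspace. -/
noncomputable def stanleySpace {K : Type*} [Field K] {V : Type*}
    (I : Ideal (MvPolynomial V K)) (u : V →₀ ℕ) (Z : Finset V) :
    Submodule K (MvPolynomial V K ⧸ I) :=
  Submodule.span K
    {x | ∃ a : V →₀ ℕ, a.support ⊆ Z ∧ x = Ideal.Quotient.mk I (monomial (u + a) (1 : K))}

/-- A Stanley decomposition of `S/I`: a finite family of Stanley spaces `u_j K[Z_j]`,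
each of which is a free `K[Z_j]`-module (expressed by linear independence of the monomial
spanning set), whose internal direct sum is all of `S/I`. -/
structure StanleyDecomposition {K : Type*} [Field K] {V : Type*}
    (I : Ideal (MvPolynomial V K)) : Type _ where
  m : ℕ
  u : Fin m → (V →₀ ℕ)
  Z : Fin m → Finset V
  free : ∀ j : Fin m, LinearIndependent K
    (fun a : {a : V →₀ ℕ // a.support ⊆ Z j} =>
      Ideal.Quotient.mk I (monomial (u j + (a : V →₀ ℕ)) (1 : K)))
  internal : DirectSum.IsInternal (fun j : Fin m => stanleySpace I (u j) (Z j))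

/-- The Stanley depth of `S/I`. -/
noncomputable def sdepthQuot {K : Type*} [Field K] {V : Type*}
    (I : Ideal (MvPolynomial V K)) : ℕ :=
  sSup {n : ℕ | ∃ D : StanleyDecomposition I, ∀ j, n ≤ (D.Z j).card}

/-- `pdimLE R n M`: the `R`-module `M` has projective dimension at most `n`,
i.e. it admits a projective resolution of length `n`. -/
def pdimLE (R : Type*) [CommRing R] :
    (n : ℕ) → (M : Type*) → [AddCommGroup M] → [Module R M] → Prop
  | 0, M, _, _ => Module.Projective R M
  | (n+1), M, _, _ => ∃ (P : Type _) (_ : AddCommGroup P) (_ : Module R P)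
      (f : P →ₗ[R] M), Module.Projective R P ∧ Function.Surjective f ∧
        pdimLE R n (LinearMap.ker f)

/-- The projective dimension of `S/I` over `S`: the length of a minimal (projective/free)
resolution, i.e. the least `n` such that `S/I` has a projective resolution of length `n`. -/
noncomputable def pdimQuot {K : Type*} [Field K] {V : Type*}
    (I : Ideal (MvPolynomial V K)) : ℕ :=
  sInf {n : ℕ | pdimLE (MvPolynomial V K) n (MvPolynomial V K ⧸ I)}

/-- The ladder graph `A n` on `2n` vertices: `inl i = x_{i+1}`, `inr i = y_{i+1}`. -/
def graphA (n : ℕ) : SimpleGraph (Fin n ⊕ Fin n) :=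
  SimpleGraph.fromRel (fun a b =>
    match a, b with
    | .inl i, .inl j => (i : ℕ) + 1 = j
    | .inr i, .inr j => (i : ℕ) + 1 = j
    | .inl i, .inr j => (i : ℕ) = (j : ℕ)
    | .inr _, .inl _ => False)

/-- The graph `B n`: the ladder `A n` with one extra vertex `y_{n+1}` and edge `{y_n, y_{n+1}}`.
Here `inl i = x_{i+1}` (`i < n`) and `inr i = y_{i+1}` (`i < n+1`). -/
def graphB (n : ℕ) : SimpleGraph (Fin n ⊕ Fin (n+1)) :=
  SimpleGraph.fromRel (fun a b =>
    match a, b with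
    | .inl i, .inl j => (i : ℕ) + 1 = j
    | .inr i, .inr j => (i : ℕ) + 1 = j
    | .inl i, .inr j => (i : ℕ) = (j : ℕ)
    | .inr _, .inl _ => False)

/-- The graph `C n`: the ladder `A n` with two extra vertices `y_{n+1}, y_{n+2}` and extra
edges `{y_n, y_{n+1}}` and `{y_1, y_{n+2}}`. Here `inl i = x_{i+1}` (`i < n`) and
`inr i = y_{i+1}` (`i < n+2`). -/
def graphC (n : ℕ) : SimpleGraph (Fin n ⊕ Fin (n+2)) :=
  SimpleGraph.fromRel (fun a b =>
    match a, b with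
    | .inl i, .inl j => (i : ℕ) + 1 = j
    | .inr i, .inr j => ((i : ℕ) + 1 = j ∧ (j : ℕ) ≤ n) ∨ ((i : ℕ) = 0 ∧ (j : ℕ) = n + 1)
    | .inl i, .inr j => (i : ℕ) = (j : ℕ)
    | .inr _, .inl _ => False)

/-- The graph `D n`: the ladder `A n` with two extra vertices `x_{n+1}, y_{n+1}` and extra
edges `{y_n, y_{n+1}}` and `{x_1, x_{n+1}}`. Here `inl i = x_{i+1}` and `inr i = y_{i+1}`
(`i < n+1`). -/
def graphD (n : ℕ) : SimpleGraph (Fin (n+1) ⊕ Fin (n+1)) :=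
  SimpleGraph.fromRel (fun a b =>
    match a, b with
    | .inl i, .inl j => ((i : ℕ) + 1 = j ∧ (j : ℕ) ≤ n - 1) ∨ ((i : ℕ) = 0 ∧ (j : ℕ) = n)
    | .inr i, .inr j => (i : ℕ) + 1 = j
    | .inl i, .inr j => (i : ℕ) = (j : ℕ) ∧ (i : ℕ) ≤ n - 1
    | .inr _, .inl _ => False)

/-- The circulant graph `C_q(s)` on vertex set `{x_1, …, x_q}` (realized as `Fin q`):
`x_i` and `x_j` are adjacent iff `|i - j| ∈ s` or `q - |i - j| ∈ s`. -/
def circulantGraph (q : ℕ) (s : Set ℕ) : SimpleGraph (Fin q) :=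
  SimpleGraph.fromRel (fun i j =>
    ((i : ℤ) - (j : ℤ)).natAbs ∈ s ∨ q - ((i : ℤ) - (j : ℤ)).natAbs ∈ s)


section Part1
variable {R : Type*} [CommRing R]

/-- elementwise weak regularity of a list on `R ⧸ I`. -/
def WR : Ideal R → List R → Prop
  | _, [] => True
  | I, r :: rs => (∀ f, r * f ∈ I → f ∈ I) ∧ WR (I ⊔ Ideal.span {r}) rs

lemma WR_node (x : R) : ∀ (rs : List R) (I I1 : Ideal R), (∀ f, f ∈ I1 ↔ x * f ∈ I) →
    WR I1 rs → WR (I ⊔ Ideal.span {x}) rs → WR I rs := by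
  intro rs
  induction rs with
  | nil => intros; trivial
  | cons r rs ih =>
    intro I I1 h h1 h2
    obtain ⟨a1, b1⟩ := h1
    obtain ⟨a2, b2⟩ := h2
    refine ⟨?_, ?_⟩
    · intro f hf
      have : f ∈ I ⊔ Ideal.span {x} := a2 f (Ideal.mem_sup_left hf)
      obtain ⟨i, hi, y, hy, rfl⟩ := Submodule.mem_sup.1 this
      obtain ⟨g, rfl⟩ := Ideal.mem_span_singleton'.1 hy
      refine I.add_mem hi ?_
      have : r * g ∈ I1 := by
        rw [h]
        have := I.sub_mem hf (I.mul_mem_left r hi)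
        convert this using 1; ring
      have := (h g).1 (a1 g this)
      rwa [mul_comm]
    · refine ih (I ⊔ Ideal.span {r}) (I1 ⊔ Ideal.span {r}) ?_ b1 ?_
      · intro f
        constructor
        · intro hf
          obtain ⟨i, hi, y, hy, rfl⟩ := Submodule.mem_sup.1 hf
          rw [mul_add]
          exact Ideal.add_mem _ (Ideal.mem_sup_left ((h i).1 hi))
            (Ideal.mem_sup_right (Ideal.mul_mem_left _ _ hy))
        · intro hf
          obtain ⟨i, hi, y, hy, e⟩ := Submodule.mem_sup.1 hf
          obtain ⟨s, rfl⟩ := Ideal.mem_span_singleton'.1 hy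
          have : s ∈ I ⊔ Ideal.span {x} := by
            apply a2
            have e2 : r * s = -i + f * x := by linear_combination e
            rw [e2]
            exact Ideal.add_mem _ (Ideal.mem_sup_left (I.neg_mem hi))
              (Ideal.mem_sup_right (Ideal.mem_span_singleton'.2 ⟨f, rfl⟩))
          obtain ⟨i', hi', y', hy', e'⟩ := Submodule.mem_sup.1 this
          obtain ⟨t, rfl⟩ := Ideal.mem_span_singleton'.1 hy'
          have e3 : f = (f - r * t) + t * r := by ring
          rw [e3]
          refine Ideal.add_mem _ (Ideal.mem_sup_left ((h _).2 ?_))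
            (Ideal.mem_sup_right (Ideal.mem_span_singleton'.2 ⟨t, rfl⟩))
          have e4 : x * (f - r * t) = i + r * i' := by
            linear_combination -e - r * e'
          rw [e4]
          exact I.add_mem hi (I.mul_mem_left _ hi')
      · rwa [sup_right_comm]

lemma WR_iff (rs : List R) : ∀ (I : Ideal R),
    RingTheory.Sequence.IsWeaklyRegular (R ⧸ I) rs ↔ WR I rs := by
  induction rs with
  | nil => intro I; simp [WR]
  | cons r rs ih =>
    intro I
    rw [RingTheory.Sequence.isWeaklyRegular_cons_iff, WR, ← ih]
    have e1 : IsSMulRegular (R ⧸ I) r ↔ ∀ f, r * f ∈ I → f ∈ I := by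
      rw [isSMulRegular_iff_right_eq_zero_of_smul]
      constructor
      · intro h f hf
        rw [← Ideal.Quotient.eq_zero_iff_mem] at hf ⊢
        apply h
        rw [Algebra.smul_def]
        simpa using hf
      · intro h m hm
        obtain ⟨f, rfl⟩ := Ideal.Quotient.mk_surjective m
        rw [Ideal.Quotient.eq_zero_iff_mem]
        apply h
        rw [← Ideal.Quotient.eq_zero_iff_mem]
        rw [Algebra.smul_def] at hm
        simpa using hm
    rw [e1]
    refine and_congr_right fun _ => ?_
    have hle : I ≤ I ⊔ Ideal.span {r} := le_sup_left
    have e : QuotSMulTop r (R ⧸ I) ≃ₗ[R] (R ⧸ (I ⊔ Ideal.span {r})) := by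
      refine (Submodule.quotEquivOfEq _ _ ?_).trans
        (Submodule.quotientQuotientEquivQuotient I (I ⊔ Ideal.span {r}) hle)
      ext y
      rw [Submodule.mem_smul_pointwise_iff_exists]
      simp only [Submodule.mem_top, true_and, Submodule.mem_map]
      constructor
      · rintro ⟨b, rfl⟩
        obtain ⟨f, rfl⟩ := Submodule.mkQ_surjective _ b
        exact ⟨r * f, Ideal.mem_sup_right (Ideal.mem_span_singleton.2 ⟨f, rfl⟩), rfl⟩
      · rintro ⟨f, hf, rfl⟩
        obtain ⟨i, hi, z, hz, rfl⟩ := Submodule.mem_sup.1 hf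
        obtain ⟨t, rfl⟩ := Ideal.mem_span_singleton'.1 hz
        refine ⟨I.mkQ t, ?_⟩
        rw [← map_smul, ← sub_eq_zero, ← map_sub, Submodule.mkQ_apply,
          Submodule.Quotient.mk_eq_zero]
        convert I.neg_mem hi using 1
        simp only [smul_eq_mul]; ring
    exact e.isWeaklyRegular_congr rs

lemma WR_regular {I m : Ideal R} {rs : List R} (hm : m ≠ ⊤) (hI : I ≤ m) (hrs : ∀ r ∈ rs, r ∈ m)
    (h : WR I rs) : RingTheory.Sequence.IsRegular (R ⧸ I) rs := by
  refine ⟨(WR_iff rs I).2 h, fun htop => hm ?_⟩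
  have h1 : Ideal.ofList rs • (⊤ : Submodule R (R ⧸ I)) ≤ Submodule.map I.mkQ m := by
    rw [Submodule.smul_le]
    intro r hr n _
    obtain ⟨f, rfl⟩ := Submodule.mkQ_surjective _ n
    have : r ∈ m := (Ideal.span_le.2 hrs) hr
    exact ⟨r * f, m.mul_mem_right _ this, rfl⟩
  rw [← htop, top_le_iff] at h1
  rw [Ideal.eq_top_iff_one]
  have : I.mkQ 1 ∈ Submodule.map I.mkQ m := by rw [h1]; trivial
  obtain ⟨y, hy, e⟩ := this
  rw [← sub_eq_zero, ← map_sub, Submodule.mkQ_apply, Submodule.Quotient.mk_eq_zero] at e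
  have := m.sub_mem hy (hI e)
  simpa using this

/-- saturation of `J + (n)` with respect to the complement of a prime. -/
def satI (m : Ideal R) [hm : m.IsPrime] (J : Ideal R) : Ideal R where
  carrier := {f | ∃ s, s ∉ m ∧ s * f ∈ J}
  add_mem' := by
    rintro a b ⟨s, hs, ha⟩ ⟨t, ht, hb⟩
    refine ⟨s * t, fun h => (hm.mem_or_mem h).elim hs ht, ?_⟩
    have e : s * t * (a + b) = t * (s * a) + s * (t * b) := by ring
    rw [e]
    exact J.add_mem (J.mul_mem_left _ ha) (J.mul_mem_left _ hb)
  zero_mem' := ⟨1, fun h => hm.ne_top ((Ideal.eq_top_iff_one _).2 h), by simp⟩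
  smul_mem' := by
    rintro c a ⟨s, hs, ha⟩
    refine ⟨s, hs, ?_⟩
    have e : s * (c • a) = c * (s * a) := by simp only [smul_eq_mul]; ring
    rw [e]
    exact J.mul_mem_left _ ha

lemma depth_step [IsNoetherianRing R] (m : Ideal R) [hm : m.IsPrime] (J P : Ideal R) (x : R)
    (h1 : ∀ p ∈ P, p * x ∈ J) (h2 : ∀ t, t * x ∈ J → t ∈ m) (r : R) (hr : r ∈ m)
    (hreg : ∀ f, r * f ∈ J → f ∈ J) :
    ∃ y, (∀ p ∈ P, p * y ∈ J ⊔ Ideal.span {r}) ∧ ∀ t, t * y ∈ J ⊔ Ideal.span {r} → t ∈ m := by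
  by_contra hcon
  push Not at hcon
  let A : Set (Ideal R) := {I | ∃ y, (∀ p ∈ P, p * y ∈ J) ∧ (∀ t, t * y ∈ J → t ∈ m) ∧
    I = satI m (J ⊔ Ideal.span {y})}
  obtain ⟨I, ⟨y, hy1, hy2, rfl⟩, hmax⟩ := set_has_maximal_iff_noetherian.2
    (inferInstance : IsNoetherian R R) A ⟨_, x, h1, h2, rfl⟩
  obtain ⟨s, hs, hsm⟩ := hcon y (fun p hp => Ideal.mem_sup_left (hy1 p hp))
  obtain ⟨j, hj, z, hz, e⟩ := Submodule.mem_sup.1 hs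
  obtain ⟨w, rfl⟩ := Ideal.mem_span_singleton'.1 hz
  have hw1 : ∀ p ∈ P, p * w ∈ J := by
    intro p hp
    apply hreg
    have e2 : r * (p * w) = s * (p * y) - p * j := by linear_combination p * e
    rw [e2]
    exact J.sub_mem (J.mul_mem_left _ (hy1 p hp)) (J.mul_mem_left _ hj)
  have hw2 : ∀ t, t * w ∈ J → t ∈ m := by
    intro t ht
    have : t * s * y ∈ J := by
      have e2 : t * s * y = t * j + r * (t * w) := by linear_combination -t * e
      rw [e2]
      exact J.add_mem (J.mul_mem_left _ hj) (J.mul_mem_left _ ht)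
    exact (hm.mem_or_mem (hy2 _ this)).resolve_right hsm
  have hle : satI m (J ⊔ Ideal.span {y}) ≤ satI m (J ⊔ Ideal.span {w}) := by
    rintro f ⟨t, ht, htf⟩
    refine ⟨s * t, fun h => (hm.mem_or_mem h).elim hsm ht, ?_⟩
    obtain ⟨i, hi, z, hz, e'⟩ := Submodule.mem_sup.1 htf
    obtain ⟨a, rfl⟩ := Ideal.mem_span_singleton'.1 hz
    have e2 : s * t * f = (s * i + a * j) + (a * r) * w := by linear_combination -s * e' - a * e
    rw [e2]
    exact Ideal.add_mem _ (Ideal.mem_sup_left (J.add_mem (J.mul_mem_left _ hi)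
      (J.mul_mem_left _ hj))) (Ideal.mem_sup_right (Ideal.mem_span_singleton'.2 ⟨_, rfl⟩))
  have heq := hle.eq_of_not_lt (hmax _ ⟨w, hw1, hw2, rfl⟩)
  have hwm : w ∈ satI m (J ⊔ Ideal.span {w}) :=
    ⟨1, fun h => hm.ne_top ((Ideal.eq_top_iff_one _).2 h),
      Ideal.mem_sup_right (Ideal.mem_span_singleton'.2 ⟨1, rfl⟩)⟩
  rw [← heq] at hwm
  obtain ⟨t, ht, htw⟩ := hwm
  obtain ⟨i, hi, z, hz, e'⟩ := Submodule.mem_sup.1 htw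
  obtain ⟨a, rfl⟩ := Ideal.mem_span_singleton'.1 hz
  have : (t * s - r * a) * y ∈ J := by
    have e2 : (t * s - r * a) * y = t * j + r * i := by linear_combination -t * e - r * e'
    rw [e2]
    exact J.add_mem (J.mul_mem_left _ hj) (J.mul_mem_left _ hi)
  have := m.add_mem (hy2 _ this) (m.mul_mem_right a hr)
  rw [sub_add_cancel] at this
  exact (hm.mem_or_mem this).elim ht hsm

lemma exists_prime_colon [IsNoetherianRing R] (m : Ideal R) [hm : m.IsPrime] (J : Ideal R) (x : R)
    (h2 : ∀ t, t * x ∈ J → t ∈ m) :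
    ∃ (Q : Ideal R) (y : R), Q.IsPrime ∧ Q ≤ m ∧ (∀ t, t * x ∈ J → t ∈ Q) ∧
      ∀ t, t * y ∈ J ↔ t ∈ Q := by
  let A : Set (Ideal R) := {Q | Q ≤ m ∧ ∃ y, (∀ t, t * x ∈ J → t ∈ Q) ∧ ∀ t, t * y ∈ J ↔ t ∈ Q}
  let col : R → Ideal R := fun y => Submodule.comap (LinearMap.mulRight R y) J
  have hcol : ∀ y t, t ∈ col y ↔ t * y ∈ J := fun y t => Iff.rfl
  obtain ⟨Q, ⟨hQm, y, hxy, hy⟩, hmax⟩ := set_has_maximal_iff_noetherian.2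
    (inferInstance : IsNoetherian R R) A
    ⟨col x, fun t ht => h2 t ht, x, fun t ht => ht, fun t => Iff.rfl⟩
  refine ⟨Q, y, ⟨fun h => hm.ne_top (top_le_iff.1 (h ▸ hQm)), ?_⟩, hQm, hxy, hy⟩
  intro a b hab
  by_contra hcon
  push Not at hcon
  obtain ⟨ha, hb⟩ := hcon
  -- colon by a * y
  have hQle : ∀ c, Q ≤ col (c * y) := by
    intro c t ht
    rw [hcol]
    have e : t * (c * y) = c * (t * y) := by ring
    rw [e]; exact J.mul_mem_left _ ((hy t).2 ht)
  have key : ∀ c, (∃ d, d ∉ Q ∧ d * (c * y) ∈ J) → ∃ s, s ∉ m ∧ s * (c * y) ∈ J := by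
    rintro c ⟨d, hd, hdc⟩
    by_contra hcon
    push Not at hcon
    have h3 : col (c * y) ≤ m := fun t ht => by
      by_contra h
      exact hcon t h ht
    refine hmax (col (c * y)) ⟨h3, c * y, fun t ht => hQle c (hxy t ht), fun t => Iff.rfl⟩ ?_
    exact lt_of_le_of_ne (hQle c) (fun h => hd (h ▸ hdc))
  obtain ⟨s, hs, hsa⟩ := key a ⟨b, hb, by
    have e : b * (a * y) = a * b * y := by ring
    rw [e]; exact (hy _).2 hab⟩
  obtain ⟨s', hs', hsa'⟩ := key s ⟨a, ha, by
    have e : a * (s * y) = s * (a * y) := by ring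
    rwa [e]⟩
  have : s' * s ∈ m := hQm ((hy _).1 (by rwa [mul_assoc]))
  exact (hm.mem_or_mem this).elim hs' hs

lemma depth_le_coheight [IsNoetherianRing R] (m : Ideal R) [hm : m.IsPrime] :
    ∀ (rs : List R) (J : Ideal R) (P : PrimeSpectrum R) (x : R), P.asIdeal ≤ m →
      (∀ t, t * x ∈ J ↔ t ∈ P.asIdeal) → (∀ r ∈ rs, r ∈ m) → WR J rs →
      (rs.length : ℕ∞) ≤ Order.coheight P := by
  intro rs
  induction rs with
  | nil => intros; simp
  | cons r rs ih =>
    intro J P x hP hx hrs hW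
    obtain ⟨hreg, hW⟩ := hW
    obtain ⟨y, hy1, hy2⟩ := depth_step m J P.asIdeal x (fun p hp => (hx p).2 hp)
      (fun t ht => hP ((hx t).1 ht)) r (hrs r (by simp)) hreg
    obtain ⟨Q, z, hQ, hQm, hQ1, hz⟩ := exists_prime_colon m _ y hy2
    have hlt : P < (⟨Q, hQ⟩ : PrimeSpectrum R) := by
      rw [← PrimeSpectrum.asIdeal_lt_asIdeal]
      refine lt_of_le_of_ne (fun p hp => hQ1 p (hy1 p hp)) ?_
      intro h
      have hr : r ∈ P.asIdeal := by
        rw [h]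
        exact hQ1 r (Ideal.mem_sup_right (Ideal.mem_span_singleton.2 ⟨y, rfl⟩))
      have := (hx 1).1 (by simpa using hreg x ((hx r).2 hr))
      exact P.isPrime.ne_top ((Ideal.eq_top_iff_one _).2 this)
    have := ih _ ⟨Q, hQ⟩ z hQm hz (fun r hr => hrs r (by simp [hr])) hW
    have h3 := Order.coheight_add_one_le hlt
    refine le_trans ?_ h3
    rw [List.length_cons]
    push_cast
    gcongr

end Part1
section Part2
variable {K : Type*} [Field K] {V : Type*} [Fintype V] [DecidableEq V]
set_option linter.unusedSectionVars false

/-- sum of the variables of a colour class. -/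
noncomputable def theta (K : Type*) [Field K] {V : Type*} [Fintype V] (c : V → ℕ) (j : ℕ) :
    MvPolynomial V K :=
  ∑ v ∈ Finset.univ.filter (fun v => c v = j), X v

noncomputable def linI (K : Type*) [Field K] {V : Type*} [Fintype V]
    (c : V → ℕ) (O : Finset V) (T : Finset ℕ) : Ideal (MvPolynomial V K) :=
  Ideal.span (X '' (O : Set V)) ⊔ Ideal.span (theta K c '' (T : Set ℕ))

noncomputable def phiT (K : Type*) [Field K] {V : Type*} [Fintype V] [DecidableEq V]
    (c : V → ℕ) (O : Finset V) (T : Finset ℕ) (rep : ℕ → V) :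
    MvPolynomial V K →ₐ[K] MvPolynomial V K :=
  aeval (fun v => if v ∈ O then 0 else if c v ∈ T ∧ v = rep (c v) then
    -∑ w ∈ (Finset.univ.filter (fun w => c w = c v)).erase v, (if w ∈ O then 0 else X w)
    else X v)

lemma linI_eq_ker (c : V → ℕ) (O : Finset V) (T : Finset ℕ) (rep : ℕ → V)
    (hrep : ∀ j ∈ T, rep j ∉ O ∧ c (rep j) = j) :
    linI K c O T = RingHom.ker (phiT K c O T rep) := by
  apply le_antisymm
  · refine sup_le (Ideal.span_le.2 ?_) (Ideal.span_le.2 ?_)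
    · rintro _ ⟨v, hv, rfl⟩
      have hv' : v ∈ O := hv
      simp [RingHom.mem_ker, phiT, hv']
    · rintro _ ⟨j, hj, rfl⟩
      have hj' : j ∈ T := hj
      obtain ⟨h1, h2⟩ := hrep j hj'
      have hm : rep j ∈ Finset.univ.filter (fun v => c v = j) := by simp [h2]
      rw [SetLike.mem_coe, RingHom.mem_ker, theta, map_sum, ← Finset.add_sum_erase _ _ hm]
      have e1 : phiT K c O T rep (X (rep j)) =
          -∑ w ∈ (Finset.univ.filter (fun w => c w = j)).erase (rep j),
            (if w ∈ O then 0 else X w) := by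
        simp [phiT, h1, h2, hj']
      rw [e1, neg_add_eq_zero]
      apply Finset.sum_congr rfl
      intro w hw
      simp only [Finset.mem_erase, Finset.mem_filter, Finset.mem_univ, true_and] at hw
      simp [phiT, hw.1, hw.2]
  · have key : (Ideal.Quotient.mkₐ K (linI K c O T)).comp (phiT K c O T rep) =
        Ideal.Quotient.mkₐ K (linI K c O T) := by
      apply MvPolynomial.algHom_ext
      intro v
      simp only [AlgHom.comp_apply, Ideal.Quotient.mkₐ_eq_mk]
      rw [Ideal.Quotient.eq]
      have hO : ∀ w ∈ O, (X w : MvPolynomial V K) ∈ linI K c O T := fun w hw =>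
        Ideal.mem_sup_left (Ideal.subset_span ⟨w, hw, rfl⟩)
      simp only [phiT, aeval_X]
      split_ifs with h1 h2
      · rw [zero_sub]; exact neg_mem (hO v h1)
      · have hm : v ∈ Finset.univ.filter (fun w => c w = c v) := by simp
        have e : (-∑ w ∈ (Finset.univ.filter (fun w => c w = c v)).erase v,
              (if w ∈ O then 0 else X w) - X v : MvPolynomial V K)
            = ∑ w ∈ (Finset.univ.filter (fun w => c w = c v)).erase v,
              (if w ∈ O then X w else 0) - theta K c (c v) := by
          rw [theta, ← Finset.add_sum_erase _ _ hm]
          have : ∑ w ∈ (Finset.univ.filter (fun w => c w = c v)).erase v, (X w : MvPolynomial V K)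
            = ∑ w ∈ (Finset.univ.filter (fun w => c w = c v)).erase v,
                (if w ∈ O then X w else 0)
              + ∑ w ∈ (Finset.univ.filter (fun w => c w = c v)).erase v,
                (if w ∈ O then 0 else X w) := by
            rw [← Finset.sum_add_distrib]
            apply Finset.sum_congr rfl
            intro w _
            split_ifs <;> simp
          rw [this]; ring
        rw [e]
        refine Ideal.sub_mem _ (Ideal.sum_mem _ ?_)
          (Ideal.mem_sup_right (Ideal.subset_span ⟨_, h2.1, rfl⟩))
        intro w _
        split_ifs with h
        · exact hO w h
        · exact Ideal.zero_mem _
      · simp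
    intro f hf
    have := DFunLike.congr_fun key f
    simp only [AlgHom.comp_apply, Ideal.Quotient.mkₐ_eq_mk] at this
    rw [(RingHom.mem_ker).1 hf, map_zero] at this
    exact Ideal.Quotient.eq_zero_iff_mem.1 this.symm

lemma linI_prime (c : V → ℕ) (O : Finset V) (T : Finset ℕ) (rep : ℕ → V)
    (hrep : ∀ j ∈ T, rep j ∉ O ∧ c (rep j) = j) : (linI K c O T).IsPrime := by
  rw [linI_eq_ker c O T rep hrep]
  exact RingHom.ker_isPrime _

lemma theta_not_mem (c : V → ℕ) (O : Finset V) (T : Finset ℕ) (rep : ℕ → V)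
    (hrep : ∀ j ∈ T, rep j ∉ O ∧ c (rep j) = j) (j : ℕ) (hj : j ∉ T) (r : V) (hr : r ∉ O)
    (hc : c r = j) : theta K c j ∉ linI K c O T := by
  rw [linI_eq_ker c O T rep hrep, RingHom.mem_ker, theta, map_sum]
  have e : ∀ v ∈ Finset.univ.filter (fun v => c v = j), phiT K c O T rep (X v) =
      if v ∈ O then 0 else X v := by
    intro v hv
    simp only [Finset.mem_filter, Finset.mem_univ, true_and] at hv
    simp [phiT, hv, hj]
  rw [Finset.sum_congr rfl e]
  intro h0
  have := congrArg (coeff (Finsupp.single r 1)) h0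
  rw [coeff_sum, Finset.sum_eq_single r] at this
  · simp [hr] at this
  · intro b _ hb
    split_ifs
    · simp
    · rw [coeff_X, if_neg]
      intro h
      exact hb ((Finsupp.single_left_injective one_ne_zero) h)
  · intro h; simp [hc] at h

lemma WR_leaf (c : V → ℕ) (O : Finset V) (rep : ℕ → V) : ∀ (l : List ℕ) (T : Finset ℕ),
    (∀ j ∈ T, rep j ∉ O ∧ c (rep j) = j) → (∀ j ∈ l, rep j ∉ O ∧ c (rep j) = j) →
    l.Nodup → (∀ j ∈ l, j ∉ T) → WR (linI K c O T) (l.map (theta K c)) := by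
  intro l
  induction l with
  | nil => intros; trivial
  | cons j l ih =>
    intro T hT hl hnd hdis
    rw [List.nodup_cons] at hnd
    refine ⟨?_, ?_⟩
    · intro f hf
      have hp := linI_prime (K := K) c O T rep hT
      refine (hp.mem_or_mem hf).resolve_left ?_
      obtain ⟨h1, h2⟩ := hl j (by simp)
      exact theta_not_mem c O T rep hT j (hdis j (by simp)) (rep j) h1 h2
    · have : linI K c O T ⊔ Ideal.span {theta K c j} = linI K c O (insert j T) := by
        rw [linI, linI, sup_assoc, ← Ideal.span_union, Finset.coe_insert, Set.image_insert_eq,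
          Set.union_singleton]
      change WR (linI K c O T ⊔ Ideal.span {theta K c j}) _
      rw [this]
      apply ih
      · intro i hi
        rcases Finset.mem_insert.1 hi with rfl | hi
        · exact hl _ (by simp)
        · exact hT i hi
      · intro i hi; exact hl i (by simp [hi])
      · exact hnd.2
      · intro i hi h
        rcases Finset.mem_insert.1 h with rfl | h
        · exact hnd.1 hi
        · exact hdis i (by simp [hi]) h

/-- edge ideal plus some variables. -/
noncomputable def JI (K : Type*) [Field K] {V : Type*} (G : SimpleGraph V) (O : Finset V) :
    Ideal (MvPolynomial V K) :=
  edgeIdeal K G ⊔ Ideal.span (X '' (O : Set V))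

def badM {V : Type*} (G : SimpleGraph V) (O : Finset V) (m : V →₀ ℕ) : Prop :=
  (∃ i j, G.Adj i j ∧ m i ≠ 0 ∧ m j ≠ 0) ∨ ∃ v ∈ O, m v ≠ 0

lemma mem_JI (G : SimpleGraph V) (O : Finset V) (f : MvPolynomial V K) :
    f ∈ JI K G O ↔ ∀ m ∈ f.support, badM G O m := by
  classical
  have e : JI K G O = Ideal.span ((fun s => monomial s (1 : K)) ''
      ({s | ∃ i j, G.Adj i j ∧ s = Finsupp.single i 1 + Finsupp.single j 1} ∪
        {s | ∃ v ∈ O, s = Finsupp.single v 1})) := by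
    rw [Set.image_union, Ideal.span_union, JI, edgeIdeal]
    congr 2
    · ext m
      constructor
      · rintro ⟨i, j, h, rfl⟩
        exact ⟨_, ⟨i, j, h, rfl⟩, by simp [X, monomial_mul]⟩
      · rintro ⟨_, ⟨i, j, h, rfl⟩, rfl⟩
        exact ⟨i, j, h, by simp [X, monomial_mul]⟩
    · ext m
      constructor
      · rintro ⟨v, h, rfl⟩
        exact ⟨_, ⟨v, h, rfl⟩, rfl⟩
      · rintro ⟨_, ⟨v, h, rfl⟩, rfl⟩
        exact ⟨v, h, rfl⟩
  rw [e, mem_ideal_span_monomial_image]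
  refine forall₂_congr fun m _ => ?_
  constructor
  · rintro ⟨_, ⟨i, j, h, rfl⟩ | ⟨v, hv, rfl⟩, hle⟩
    · left
      refine ⟨i, j, h, ?_, ?_⟩
      · have := hle i; simp at this; omega
      · have := hle j; simp at this; omega
    · right
      refine ⟨v, hv, ?_⟩
      have := hle v; simp at this; omega
  · rintro (⟨i, j, h, hi, hj⟩ | ⟨v, hv, hm⟩)
    · refine ⟨_, Or.inl ⟨i, j, h, rfl⟩, fun w => ?_⟩
      have := h.ne
      simp only [Finsupp.add_apply, Finsupp.single_apply]
      split_ifs with h1 h2 h2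
      · exact absurd (h1.trans h2.symm) this
      · subst h1; omega
      · subst h2; omega
      · omega
    · refine ⟨_, Or.inr ⟨v, hv, rfl⟩, fun w => ?_⟩
      simp only [Finsupp.single_apply]
      split_ifs with h1
      · subst h1; omega
      · omega

lemma JI_empty (G : SimpleGraph V) : JI K G ∅ = edgeIdeal K G := by simp [JI]

lemma JI_insert (G : SimpleGraph V) (O : Finset V) (v : V) :
    JI K G O ⊔ Ideal.span {X v} = JI K G (insert v O) := by
  rw [JI, JI, sup_assoc, ← Ideal.span_union, Finset.coe_insert, Set.image_insert_eq,
    Set.union_singleton]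

lemma JI_colon (G : SimpleGraph V) (O N : Finset V) (v : V) (hv : v ∉ O)
    (hN : ∀ w, w ∈ N ↔ G.Adj v w) (f : MvPolynomial V K) :
    f ∈ JI K G (O ∪ N) ↔ X v * f ∈ JI K G O := by
  rw [mem_JI, mem_JI, support_X_mul]
  simp only [Finset.mem_map, addLeftEmbedding_apply, forall_exists_index, and_imp,
    forall_apply_eq_imp_iff₂]
  refine forall₂_congr fun m _ => ?_
  constructor
  · rintro (⟨i, j, h, hi, hj⟩ | ⟨w, hw, hm⟩)
    · exact Or.inl ⟨i, j, h, by simp [hi], by simp [hj]⟩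
    · rcases Finset.mem_union.1 hw with hw | hw
      · exact Or.inr ⟨w, hw, by simp [hm]⟩
      · exact Or.inl ⟨v, w, (hN w).1 hw, by simp, by simp [hm]⟩
  · have key : ∀ w, w ≠ v → (Finsupp.single v 1 + m : V →₀ ℕ) w ≠ 0 → m w ≠ 0 := by
      intro w hw h
      simpa [Finsupp.single_apply, hw.symm] using h
    rintro (⟨i, j, h, hi, hj⟩ | ⟨w, hw, hm⟩)
    · by_cases hiv : i = v
      · subst hiv
        exact Or.inr ⟨j, Finset.mem_union_right _ ((hN j).2 h), key j h.ne' hj⟩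
      · by_cases hjv : j = v
        · subst hjv
          exact Or.inr ⟨i, Finset.mem_union_right _ ((hN i).2 h.symm), key i hiv hi⟩
        · exact Or.inl ⟨i, j, h, key i hiv hi, key j hjv hj⟩
    · refine Or.inr ⟨w, Finset.mem_union_left _ hw, key w ?_ hm⟩
      rintro rfl; exact hv hw

inductive Good (G : SimpleGraph V) (c : V → ℕ) (d : ℕ) : Finset V → Prop
  | leaf (O : Finset V) : (∀ i j, G.Adj i j → i ∈ O ∨ j ∈ O) → (∀ k < d, ∃ v, v ∉ O ∧ c v = k) →
      Good G c d O
  | node (O : Finset V) (v : V) (N : Finset V) : v ∉ O → (∀ w, w ∈ N ↔ G.Adj v w) →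
      Good G c d (O ∪ N) → Good G c d (insert v O) → Good G c d O

lemma Good.WR [Nonempty V] {G : SimpleGraph V} {c : V → ℕ} {d : ℕ} {O : Finset V}
    (h : Good G c d O) : WR (JI K G O) ((List.range d).map (theta K c)) := by
  induction h with
  | leaf O h1 h2 =>
    have : ∃ rep : ℕ → V, ∀ k < d, rep k ∉ O ∧ c (rep k) = k := by
      choose! rep hrep using h2
      exact ⟨rep, hrep⟩
    obtain ⟨rep, hrep⟩ := this
    have e : JI K G O = linI K c O ∅ := by
      rw [JI, linI]
      simp only [Finset.coe_empty, Set.image_empty, Ideal.span_empty, sup_bot_eq, sup_eq_right]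
      rw [edgeIdeal, Ideal.span_le]
      rintro _ ⟨i, j, h, rfl⟩
      rcases h1 i j h with h | h
      · exact Ideal.mul_mem_right _ _ (Ideal.subset_span ⟨i, h, rfl⟩)
      · exact Ideal.mul_mem_left _ _ (Ideal.subset_span ⟨j, h, rfl⟩)
    rw [e]
    exact WR_leaf c O rep _ ∅ (by simp) (fun j hj => hrep j (List.mem_range.1 hj))
      List.nodup_range (by simp)
  | node O v N hv hN _ _ ih1 ih2 =>
    refine WR_node (X v) _ _ (JI K G (O ∪ N)) (JI_colon G O N v hv hN) ih1 ?_
    rw [JI_insert]; exact ih2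

lemma maxIdeal_eq : maxIdeal K V = linI K (fun _ : V => 0) Finset.univ ∅ := by
  simp [maxIdeal, linI]

instance maxIdeal_prime : (maxIdeal K V).IsPrime := by
  rcases isEmpty_or_nonempty V with h | h
  · have : maxIdeal K V = ⊥ := by simp [maxIdeal]
    rw [this]; exact Ideal.isPrime_bot
  · rw [maxIdeal_eq]
    exact linI_prime _ _ _ (fun _ => h.some) (by simp)

lemma edgeIdeal_le_max (G : SimpleGraph V) : edgeIdeal K G ≤ maxIdeal K V := by
  rw [edgeIdeal, Ideal.span_le]
  rintro _ ⟨i, j, h, rfl⟩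
  exact Ideal.mul_mem_right _ _ (Ideal.subset_span ⟨i, rfl⟩)

lemma theta_mem_max (c : V → ℕ) (j : ℕ) : theta K c j ∈ maxIdeal K V :=
  Ideal.sum_mem _ fun v _ => Ideal.subset_span ⟨v, rfl⟩

lemma depth_lower [Nonempty V] {G : SimpleGraph V} {c : V → ℕ} {d : ℕ} (h : Good G c d ∅) :
    ∃ rs : List (MvPolynomial V K), rs.length = d ∧
    (∀ r ∈ rs, r ∈ maxIdeal K V) ∧
    RingTheory.Sequence.IsRegular (MvPolynomial V K ⧸ edgeIdeal K G) rs := by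
  have hm : ∀ r ∈ (List.range d).map (theta K c), r ∈ maxIdeal K V := by
    intro r hr
    obtain ⟨j, _, rfl⟩ := List.mem_map.1 hr
    exact theta_mem_max c j
  refine ⟨(List.range d).map (theta K c), by simp, hm, ?_⟩
  refine WR_regular (maxIdeal_prime (K := K) (V := V)).ne_top (edgeIdeal_le_max G) hm ?_
  rw [← JI_empty]
  exact h.WR

/-- exponent vector of a set. -/
noncomputable def chi (W : Finset V) : V →₀ ℕ :=
  Finsupp.equivFunOnFinite.symm (fun v => if v ∈ W then 1 else 0)

@[simp] lemma chi_apply (W : Finset V) (v : V) : chi W v = if v ∈ W then 1 else 0 := rfl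

lemma colon_chi (G : SimpleGraph V) (W : Finset V) (h1 : ∀ i ∈ W, ∀ j ∈ W, ¬ G.Adj i j)
    (h2 : ∀ v, v ∉ W → ∃ w ∈ W, G.Adj v w) (t : MvPolynomial V K) :
    t * monomial (chi W) 1 ∈ edgeIdeal K G ↔ t ∈ linI K (fun _ => 0) (Finset.univ \ W) ∅ := by
  have e : linI K (fun _ => 0) (Finset.univ \ W) ∅ =
      Ideal.span (X '' ((Finset.univ \ W : Finset V) : Set V)) := by simp [linI]
  rw [e, mem_ideal_span_X_image, ← JI_empty, mem_JI]
  have e2 : (t * monomial (chi W) (1 : K)).support = t.support.map (addRightEmbedding (chi W)) :=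
    AddMonoidAlgebra.support_coeff_mul_single _ _ (by simp) _
  rw [e2]
  simp only [Finset.mem_map, addRightEmbedding_apply, forall_exists_index, and_imp,
    forall_apply_eq_imp_iff₂]
  refine forall₂_congr fun m _ => ?_
  constructor
  · rintro (⟨i, j, h, hi, hj⟩ | ⟨w, hw, hm⟩)
    · by_cases hiW : i ∈ W
      · by_cases hjW : j ∈ W
        · exact absurd h (h1 i hiW j hjW)
        · exact ⟨j, by simpa using hjW, by simpa [hjW] using hj⟩
      · exact ⟨i, by simpa using hiW, by simpa [hiW] using hi⟩
    · simp at hw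
  · rintro ⟨v, hv, hm⟩
    have hv' : v ∉ W := by simpa using hv
    obtain ⟨w, hw, ha⟩ := h2 v hv'
    exact Or.inl ⟨v, w, ha, by simp [hm], by simp [hw]⟩

lemma depth_upper [Nonempty V] (G : SimpleGraph V) (W : Finset V)
    (h1 : ∀ i ∈ W, ∀ j ∈ W, ¬ G.Adj i j)
    (h2 : ∀ v, v ∉ W → ∃ w ∈ W, G.Adj v w) (rs : List (MvPolynomial V K))
    (hrs : ∀ r ∈ rs, r ∈ maxIdeal K V)
    (hreg : RingTheory.Sequence.IsRegular (MvPolynomial V K ⧸ edgeIdeal K G) rs) :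
    rs.length ≤ W.card := by
  have hP := linI_prime (K := K) (fun _ => 0) (Finset.univ \ W) ∅
    (fun _ => Classical.arbitrary V) (by simp)
  have hle : linI K (fun _ => 0) (Finset.univ \ W) ∅ ≤ maxIdeal K V := by
    simp only [linI, Finset.coe_empty, Set.image_empty, Ideal.span_empty, sup_bot_eq]
    exact Ideal.span_mono (Set.image_subset_range _ _)
  have := depth_le_coheight (maxIdeal K V) rs (edgeIdeal K G) ⟨_, hP⟩ (monomial (chi W) 1)
    hle (colon_chi G W h1 h2) hrs ((WR_iff _ _).1 hreg.toIsWeaklyRegular)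
  have h3 : (Order.coheight (⟨_, hP⟩ : PrimeSpectrum (MvPolynomial V K)) : WithBot ℕ∞) ≤
      (W.card : ℕ∞) := by
    rw [Order.coheight_eq_krullDim_Ici]
    have e : Set.Ici (⟨_, hP⟩ : PrimeSpectrum (MvPolynomial V K)) =
        PrimeSpectrum.zeroLocus (linI K (fun _ => 0) (Finset.univ \ W) ∅ : Set _) := by
      ext Q; exact Iff.rfl
    rw [e, ← ringKrullDim_quotient]
    let g : MvPolynomial W K →ₐ[K]
        (MvPolynomial V K ⧸ linI K (fun _ => 0) (Finset.univ \ W) ∅) :=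
      (Ideal.Quotient.mkₐ K _).comp (rename (fun w : W => (w : V)))
    have hs : Function.Surjective g := by
      rw [← AlgHom.range_eq_top, eq_top_iff]
      have ht : (⊤ : Subalgebra K (MvPolynomial V K ⧸ linI K (fun _ => 0) (Finset.univ \ W) ∅))
          = Subalgebra.map (Ideal.Quotient.mkₐ K _) ⊤ := by
        rw [Algebra.map_top, eq_comm, AlgHom.range_eq_top]
        exact Ideal.Quotient.mkₐ_surjective _ _
      rw [ht, ← MvPolynomial.adjoin_range_X, AlgHom.map_adjoin, Algebra.adjoin_le_iff]
      rintro _ ⟨_, ⟨v, rfl⟩, rfl⟩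
      by_cases hv : v ∈ W
      · exact ⟨X ⟨v, hv⟩, by simp [g]⟩
      · refine ⟨0, ?_⟩
        rw [map_zero, eq_comm]
        exact Ideal.Quotient.eq_zero_iff_mem.2
          (Ideal.mem_sup_left (Ideal.subset_span ⟨v, by simpa using hv, rfl⟩))
    refine (ringKrullDim_le_of_surjective g.toRingHom hs).trans ?_
    rw [MvPolynomial.ringKrullDim_of_isNoetherianRing, ringKrullDim_eq_zero_of_field]
    simp
  have h4 : (rs.length : ℕ∞) ≤ (W.card : ℕ∞) := this.trans (by exact_mod_cast h3)
  exact_mod_cast h4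

end Part2
section Part3
set_option linter.unusedSectionVars false
variable {K : Type*} [Field K] {V : Type*} [Fintype V] [DecidableEq V]

/-- coefficient functional on the quotient by the edge ideal. -/
lemma exists_coeff_functional (G : SimpleGraph V) (m : V →₀ ℕ) (hm : ¬ badM G ∅ m) :
    ∃ φ : (MvPolynomial V K ⧸ edgeIdeal K G) →ₗ[K] K,
      ∀ f, φ (Ideal.Quotient.mk (edgeIdeal K G) f) = coeff m f := by
  have h : (edgeIdeal K G).restrictScalars K ≤ LinearMap.ker (lcoeff K m) := by
    intro f hf
    rw [LinearMap.mem_ker, lcoeff_apply]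
    have hf' : f ∈ JI K G ∅ := by rw [JI_empty]; exact hf
    by_contra hne
    exact hm ((mem_JI G ∅ f).1 hf' m (mem_support_iff.2 hne))
  refine ⟨(Submodule.liftQ _ (lcoeff K m) h) ∘ₗ
    (Submodule.Quotient.restrictScalarsEquiv K (edgeIdeal K G)).symm.toLinearMap, ?_⟩
  intro f
  rfl

lemma mk_monomial_ne (G : SimpleGraph V) (m : V →₀ ℕ)
    (h : Ideal.Quotient.mk (edgeIdeal K G) (monomial m (1 : K)) ≠ 0) : ¬ badM G ∅ m := by
  intro hb
  apply h
  rw [Ideal.Quotient.eq_zero_iff_mem, ← JI_empty, mem_JI]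
  intro m' hm'
  have := support_monomial_subset hm'
  rw [Finset.mem_singleton] at this
  rwa [this]

lemma sdepth_upper (G : SimpleGraph V) (W : Finset V)
    (h1 : ∀ i ∈ W, ∀ j ∈ W, ¬ G.Adj i j)
    (h2 : ∀ v, v ∉ W → ∃ w ∈ W, G.Adj v w) (D : StanleyDecomposition (edgeIdeal K G)) (k : ℕ)
    (hk : ∀ j, k ≤ (D.Z j).card) : k ≤ W.card := by
  have hW : ¬ badM G ∅ (chi W) := by
    rintro (⟨i, j, h, hi, hj⟩ | ⟨v, hv, _⟩)
    · simp at hi hj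
      exact h1 i hi j hj h
    · simp at hv
  obtain ⟨φ, hφ⟩ := exists_coeff_functional (K := K) G (chi W) hW
  have key : ∃ j, ∃ a : V →₀ ℕ, a.support ⊆ D.Z j ∧ D.u j + a = chi W := by
    by_contra hcon
    push Not at hcon
    have htop := D.internal.submodule_iSup_eq_top
    have hle : (⨆ j, stanleySpace (edgeIdeal K G) (D.u j) (D.Z j)) ≤ LinearMap.ker φ := by
      refine iSup_le fun j => Submodule.span_le.2 ?_
      rintro _ ⟨a, ha, rfl⟩
      rw [SetLike.mem_coe, LinearMap.mem_ker, hφ, coeff_monomial, if_neg (hcon j a ha)]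
    rw [htop] at hle
    have := hle (Submodule.mem_top (x := Ideal.Quotient.mk _ (monomial (chi W) (1 : K))))
    rw [LinearMap.mem_ker, hφ, coeff_monomial, if_pos rfl] at this
    exact one_ne_zero this
  obtain ⟨j, a, ha, e⟩ := key
  refine (hk j).trans (Finset.card_le_card ?_)
  intro z hz
  by_contra hzW
  have hs : (a + Finsupp.single z 1).support ⊆ D.Z j := by
    refine Finsupp.support_add.trans (Finset.union_subset ha ?_)
    refine Finsupp.support_single_subset.trans ?_
    simpa using hz
  have hne := (D.free j).ne_zero ⟨a + Finsupp.single z 1, hs⟩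
  have := mk_monomial_ne G _ hne
  simp only [← add_assoc, e] at this
  apply this
  obtain ⟨w, hw, hadj⟩ := h2 z hzW
  exact Or.inl ⟨z, w, hadj, by simp, by simp [hw]⟩

def IA (G : SimpleGraph V) (O F : Finset V) : Prop :=
  (∀ i ∈ F, ∀ j ∈ F, ¬ G.Adj i j) ∧ ∀ v ∈ O, v ∉ F

lemma Good.part {G : SimpleGraph V} {c : V → ℕ} {d : ℕ} {O : Finset V}
    (h : Good G c d O) : ∃ L : Finset (Finset V × Finset V),
      (∀ p ∈ L, p.1 ⊆ p.2 ∧ d ≤ p.2.card) ∧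
      (∀ F, IA G O F ↔ ∃ p ∈ L, p.1 ⊆ F ∧ F ⊆ p.2) ∧
      (∀ p ∈ L, ∀ q ∈ L, ∀ F, p.1 ⊆ F → F ⊆ p.2 → q.1 ⊆ F → F ⊆ q.2 → p = q) := by
  induction h with
  | leaf O h1 h2 =>
    refine ⟨{(∅, Finset.univ \ O)}, ?_, ?_, ?_⟩
    · intro p hp
      rw [Finset.mem_singleton] at hp
      subst hp
      refine ⟨by simp, ?_⟩
      have : Finset.range d ⊆ (Finset.univ \ O).image c := by
        intro k hk
        obtain ⟨v, hv, e⟩ := h2 k (Finset.mem_range.1 hk)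
        exact Finset.mem_image.2 ⟨v, by simpa using hv, e⟩
      have := (Finset.card_le_card this).trans Finset.card_image_le
      simpa using this
    · intro F
      simp only [Finset.mem_singleton, exists_eq_left, Finset.empty_subset, true_and]
      constructor
      · intro h v hv
        simp only [Finset.mem_sdiff, Finset.mem_univ, true_and]
        exact fun hO => h.2 v hO hv
      · intro h
        have h' : ∀ v ∈ F, v ∉ O := fun v hv => by simpa using h hv
        refine ⟨fun i hi j hj ha => ?_, fun v hv hF => h' v hF hv⟩
        rcases h1 i j ha with h | h
        · exact h' i hi h
        · exact h' j hj h
    · intro p hp q hq _ _ _ _ _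
      rw [Finset.mem_singleton] at hp hq
      rw [hp, hq]
  | node O v N hv hN _ _ ih1 ih2 =>
    obtain ⟨L1, a1, b1, c1⟩ := ih1
    obtain ⟨L2, a2, b2, c2⟩ := ih2
    have hL2 : ∀ p ∈ L2, ∀ F, p.1 ⊆ F → F ⊆ p.2 → v ∉ F := by
      intro p hp F h3 h4
      exact ((b2 F).2 ⟨p, hp, h3, h4⟩).2 v (by simp)
    have hmem : ∀ p, p ∈ (L1.filter (fun p => v ∈ p.2)).image (fun p => (insert v p.1, p.2)) ∪ L2 ↔
        (∃ q ∈ L1, v ∈ q.2 ∧ p = (insert v q.1, q.2)) ∨ p ∈ L2 := by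
      intro p
      simp only [Finset.mem_union, Finset.mem_image, Finset.mem_filter]
      refine or_congr ⟨?_, ?_⟩ Iff.rfl
      · rintro ⟨q, ⟨h1, h2⟩, rfl⟩; exact ⟨q, h1, h2, rfl⟩
      · rintro ⟨q, h1, h2, rfl⟩; exact ⟨q, ⟨h1, h2⟩, rfl⟩
    refine ⟨(L1.filter (fun p => v ∈ p.2)).image (fun p => (insert v p.1, p.2)) ∪ L2, ?_, ?_, ?_⟩
    · intro p hp
      rcases (hmem p).1 hp with ⟨q, hq, hvq, rfl⟩ | hp
      · exact ⟨Finset.insert_subset hvq (a1 q hq).1, (a1 q hq).2⟩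
      · exact a2 p hp
    · intro F
      by_cases hF : v ∈ F
      · have e : IA G O F ↔ IA G (O ∪ N) F := by
          constructor
          · rintro ⟨h1, h2⟩
            refine ⟨h1, fun w hw => ?_⟩
            rcases Finset.mem_union.1 hw with hw | hw
            · exact h2 w hw
            · exact fun h => h1 v hF w h ((hN w).1 hw)
          · rintro ⟨h1, h2⟩
            exact ⟨h1, fun w hw => h2 w (Finset.mem_union_left _ hw)⟩
        rw [e, b1]
        constructor
        · rintro ⟨p, hp, h3, h4⟩
          exact ⟨(insert v p.1, p.2), (hmem _).2 (Or.inl ⟨p, hp, h4 hF, rfl⟩),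
            Finset.insert_subset hF h3, h4⟩
        · rintro ⟨p, hp, h3, h4⟩
          rcases (hmem p).1 hp with ⟨q, hq, hvq, rfl⟩ | hp
          · exact ⟨q, hq, (Finset.subset_insert _ _).trans h3, h4⟩
          · exact absurd hF (hL2 p hp F h3 h4)
      · have e : IA G O F ↔ IA G (insert v O) F := by
          constructor
          · rintro ⟨h1, h2⟩
            refine ⟨h1, fun w hw => ?_⟩
            rcases Finset.mem_insert.1 hw with rfl | hw
            · exact hF
            · exact h2 w hw
          · rintro ⟨h1, h2⟩
            exact ⟨h1, fun w hw => h2 w (Finset.mem_insert_of_mem hw)⟩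
        rw [e, b2]
        constructor
        · rintro ⟨p, hp, h3⟩
          exact ⟨p, (hmem p).2 (Or.inr hp), h3⟩
        · rintro ⟨p, hp, h3, h4⟩
          rcases (hmem p).1 hp with ⟨q, hq, hvq, rfl⟩ | hp
          · exact absurd (h3 (Finset.mem_insert_self _ _)) hF
          · exact ⟨p, hp, h3, h4⟩
    · intro p hp q hq F h3 h4 h5 h6
      rcases (hmem p).1 hp with ⟨p', hp', hvp, rfl⟩ | hp
      · rcases (hmem q).1 hq with ⟨q', hq', hvq, rfl⟩ | hq
        · rw [c1 p' hp' q' hq' F ((Finset.subset_insert _ _).trans h3) h4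
            ((Finset.subset_insert _ _).trans h5) h6]
        · exact absurd (h3 (Finset.mem_insert_self _ _)) (hL2 q hq F h5 h6)
      · rcases (hmem q).1 hq with ⟨q', hq', hvq, rfl⟩ | hq
        · exact absurd (h5 (Finset.mem_insert_self _ _)) (hL2 p hp F h3 h4)
        · exact c2 p hp q hq F h3 h4 h5 h6

lemma badM_iff (G : SimpleGraph V) (m : V →₀ ℕ) : ¬ badM G ∅ m ↔ IA G ∅ m.support := by
  simp only [badM, IA, Finsupp.mem_support_iff, Finset.notMem_empty, false_and, exists_false,
    or_false, false_imp_iff, implies_true, and_true]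
  push Not
  constructor
  · intro h i hi j hj ha
    exact hj (h i j ha hi)
  · intro h i j ha hi
    by_contra hj
    exact h i hi j hj ha

lemma supp_chi_add (A Z : Finset V) (hAZ : A ⊆ Z) (a : V →₀ ℕ) (ha : a.support ⊆ Z) :
    A ⊆ (chi A + a).support ∧ (chi A + a).support ⊆ Z := by
  constructor
  · intro v hv
    simp [hv]
  · intro v hv
    by_cases hA : v ∈ A
    · exact hAZ hA
    · apply ha
      simpa [hA] using hv

lemma exists_chi_add (A Z : Finset V) (b : V →₀ ℕ) (h1 : A ⊆ b.support) (h2 : b.support ⊆ Z) :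
    ∃ a : V →₀ ℕ, a.support ⊆ Z ∧ b = chi A + a := by
  refine ⟨b - chi A, ?_, ?_⟩
  · intro v hv
    apply h2
    simp only [Finsupp.mem_support_iff, Finsupp.tsub_apply] at hv ⊢
    omega
  · ext v
    simp only [Finsupp.add_apply, Finsupp.tsub_apply, chi_apply]
    split_ifs with h
    · have := h1 h
      simp only [Finsupp.mem_support_iff] at this
      omega
    · omega

lemma sdepth_lower {G : SimpleGraph V} {c : V → ℕ} {d : ℕ} (h : Good G c d ∅) :
    ∃ D : StanleyDecomposition (edgeIdeal K G), ∀ j, d ≤ (D.Z j).card := by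
  obtain ⟨L, hL1, hL2, hL3⟩ := h.part
  let e : Fin L.card → Finset V × Finset V := fun j => (L.equivFin.symm j).1
  have heL : ∀ j, e j ∈ L := fun j => (L.equivFin.symm j).2
  have hinj : Function.Injective e := fun i j hij =>
    L.equivFin.symm.injective (Subtype.ext hij)
  have hsurj : ∀ p ∈ L, ∃ j, e j = p := fun p hp =>
    ⟨L.equivFin ⟨p, hp⟩, by simp [e]⟩
  have hnb : ∀ j (a : V →₀ ℕ), a.support ⊆ (e j).2 → ¬ badM G ∅ (chi (e j).1 + a) := by
    intro j a ha
    rw [badM_iff, hL2]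
    exact ⟨e j, heL j, supp_chi_add _ _ (hL1 _ (heL j)).1 a ha⟩
  have hdist : ∀ i j (a b : V →₀ ℕ), a.support ⊆ (e i).2 → b.support ⊆ (e j).2 →
      chi (e i).1 + a = chi (e j).1 + b → i = j := by
    intro i j a b ha hb hab
    apply hinj
    have h1 := supp_chi_add _ _ (hL1 _ (heL i)).1 a ha
    have h2 := supp_chi_add _ _ (hL1 _ (heL j)).1 b hb
    rw [← hab] at h2
    exact hL3 _ (heL i) _ (heL j) _ h1.1 h1.2 h2.1 h2.2
  refine ⟨⟨L.card, fun j => chi (e j).1, fun j => (e j).2, ?_, ?_⟩, fun j => (hL1 _ (heL j)).2⟩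
  · intro j
    rw [linearIndependent_iff']
    intro s g hg i hi
    obtain ⟨φ, hφ⟩ := exists_coeff_functional (K := K) G _ (hnb j i.1 i.2)
    have := congrArg φ hg
    rw [map_sum, map_zero, Finset.sum_eq_single i] at this
    · rw [map_smul, hφ, coeff_monomial, if_pos rfl] at this
      simpa using this
    · intro b _ hb
      rw [map_smul, hφ, coeff_monomial, if_neg, smul_zero]
      intro h
      exact hb (Subtype.ext (add_left_cancel h))
    · intro h; exact absurd hi h
  · rw [DirectSum.isInternal_submodule_iff_iSupIndep_and_iSup_eq_top]
    constructor
    · rw [iSupIndep_def]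
      intro i
      rw [Submodule.disjoint_def]
      intro x hx hx'
      obtain ⟨f, rfl⟩ := Ideal.Quotient.mk_surjective x
      rw [Ideal.Quotient.eq_zero_iff_mem, ← JI_empty, mem_JI]
      intro m hm
      by_contra hb
      obtain ⟨φ, hφ⟩ := exists_coeff_functional (K := K) G m hb
      rw [mem_support_iff, ← hφ] at hm
      apply hm
      by_cases hmi : ∃ a : V →₀ ℕ, a.support ⊆ (e i).2 ∧ m = chi (e i).1 + a
      · obtain ⟨a, ha, rfl⟩ := hmi
        have hle : (⨆ j, ⨆ (_ : j ≠ i), stanleySpace (edgeIdeal K G) (chi (e j).1) (e j).2) ≤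
            LinearMap.ker φ := by
          refine iSup_le fun j => iSup_le fun hj => Submodule.span_le.2 ?_
          rintro _ ⟨b, hb, rfl⟩
          rw [SetLike.mem_coe, LinearMap.mem_ker, hφ, coeff_monomial, if_neg]
          intro h
          exact hj (hdist j i b a hb ha h)
        exact hle hx'
      · have hle : stanleySpace (edgeIdeal K G) (chi (e i).1) (e i).2 ≤ LinearMap.ker φ := by
          refine Submodule.span_le.2 ?_
          rintro _ ⟨b, hb, rfl⟩
          rw [SetLike.mem_coe, LinearMap.mem_ker, hφ, coeff_monomial, if_neg]
          intro h
          exact hmi ⟨b, hb, h.symm⟩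
        exact hle hx
    · rw [eq_top_iff]
      intro x _
      obtain ⟨f, rfl⟩ := Ideal.Quotient.mk_surjective x
      rw [f.as_sum, map_sum]
      refine Submodule.sum_mem _ fun m _ => ?_
      have e1 : Ideal.Quotient.mk (edgeIdeal K G) (monomial m (coeff m f)) =
          coeff m f • Ideal.Quotient.mk (edgeIdeal K G) (monomial m (1 : K)) := by
        have : monomial m (coeff m f) = coeff m f • monomial m (1 : K) := by
          rw [smul_monomial, smul_eq_mul, mul_one]
        rw [this]; rfl
      rw [e1]
      refine Submodule.smul_mem _ _ ?_
      by_cases h0 : Ideal.Quotient.mk (edgeIdeal K G) (monomial m (1 : K)) = 0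
      · rw [h0]; exact Submodule.zero_mem _
      · have hb := mk_monomial_ne G m h0
        rw [badM_iff, hL2] at hb
        obtain ⟨p, hp, h1, h2⟩ := hb
        obtain ⟨j, rfl⟩ := hsurj p hp
        obtain ⟨a, ha, rfl⟩ := exists_chi_add _ _ _ h1 h2
        exact Submodule.mem_iSup_of_mem j (Submodule.subset_span ⟨a, ha, rfl⟩)

end Part3
section Part4

/-- Column index and side coordinates on the vertex set of a ladder-like graph. -/
structure LadderLike {V : Type*} (G : SimpleGraph V) (n : ℕ) (col : V → ℕ) (side : V → Bool) :
    Prop where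
  ext : ∀ v w, col v = col w → side v = side w → v = w
  exi : ∀ i s, (i < n ∨ (i = n ∧ s = true)) → ∃ v, col v = i ∧ side v = s
  bd : ∀ v, col v < n ∨ (col v = n ∧ side v = true)
  adj : ∀ v w, G.Adj v w ↔ (col v = col w ∧ side v ≠ side w) ∨
    (side v = side w ∧ (col v + 1 = col w ∨ col w + 1 = col v))

variable {V : Type*} [Fintype V] [DecidableEq V]

set_option maxHeartbeats 1000000 in
lemma ladder_good {G : SimpleGraph V} {n : ℕ} {col : V → ℕ} {side : V → Bool}
    (H : LadderLike G n col side) (m : ℕ) :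
    (∀ (j : ℕ) (s : Bool) (O : Finset V), n + 1 = m + 2 * j → (m = n + 1 → s = true) →
      (∀ v, col v < m → (v ∈ O ↔ col v + 1 = m ∧ side v = !s)) →
      (∀ v w, G.Adj v w → m ≤ col v → v ∈ O ∨ w ∈ O) →
      (∀ k < j, ∃ v, v ∉ O ∧ m ≤ col v ∧ (n - col v) / 2 = k) →
      Good G (fun v => (n - col v) / 2) (n / 2 + 1) O) ∧
    (∀ (j : ℕ) (s : Bool) (O : Finset V) (z : V), n + 1 = m + 2 * j → col z = m → side z = s →
      m < n → z ∉ O →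
      (∀ v, col v < m → v ∉ O) →
      (∀ v w, G.Adj v w → m ≤ col v → v ∈ O ∨ w ∈ O ∨ (v = z ∧ col w + 1 = m)) →
      (∀ k < j, ∃ v, v ∉ O ∧ v ≠ z ∧ m ≤ col v ∧ (n - col v) / 2 = k) →
      Good G (fun v => (n - col v) / 2) (n / 2 + 1) O) := by
  classical
  obtain ⟨hext, hexi, hbd, hadj⟩ := H
  have irr : ∀ v, ¬ G.Adj v v := fun v => G.irrefl
  have hsymm : ∀ v w, G.Adj v w → G.Adj w v := fun v w h => h.symm
  induction m using Nat.strong_induction_on with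
  | _ m ih =>
  have hP : ∀ (j : ℕ) (s : Bool) (O : Finset V), n + 1 = m + 2 * j → (m = n + 1 → s = true) →
      (∀ v, col v < m → (v ∈ O ↔ col v + 1 = m ∧ side v = !s)) →
      (∀ v w, G.Adj v w → m ≤ col v → v ∈ O ∨ w ∈ O) →
      (∀ k < j, ∃ v, v ∉ O ∧ m ≤ col v ∧ (n - col v) / 2 = k) →
      Good G (fun v => (n - col v) / 2) (n / 2 + 1) O := by
    intro j s O hj hs h1 h2 h3
    rcases Nat.lt_or_ge m 2 with hm | hm
    · refine Good.leaf O ?_ ?_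
      · intro v w hvw
        by_cases hv : m ≤ col v
        · exact h2 v w hvw hv
        by_cases hw : m ≤ col w
        · exact (h2 w v (hsymm _ _ hvw) hw).symm
        have e1 := h1 v (by omega)
        have e2 := h1 w (by omega)
        have := (hadj v w).1 hvw
        have c1 : side v ≠ side w := by
          rcases this with h | h
          · exact h.2
          · omega
        rw [e1, e2]
        have c2 : side v = (!s) ∨ side w = (!s) := by
          revert c1
          cases side v <;> cases side w <;> cases s <;> simp
        rcases c2 with h | h
        · exact Or.inl ⟨by omega, h⟩
        · exact Or.inr ⟨by omega, h⟩
      · intro k hk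
        by_cases hkj : k < j
        · obtain ⟨v, hv, _, hc⟩ := h3 k hkj
          exact ⟨v, hv, hc⟩
        · have hm1 : m = 1 := by omega
          obtain ⟨v, hv1, hv2⟩ := hexi 0 s (by rcases Nat.eq_zero_or_pos n with h | h <;> grind)
          refine ⟨v, ?_, ?_⟩
          · rw [h1 v (by omega), hv2]; cases s <;> simp
          · show (n - col v) / 2 = k
            omega
    · obtain ⟨u, hu1, hu2⟩ := hexi (m - 2) s (by omega)
      obtain ⟨a, ha1, ha2⟩ := hexi (m - 1) s (by
        by_cases h : m = n + 1
        · right; exact ⟨by omega, hs h⟩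
        · left; omega)
      have huO : u ∉ O := by rw [h1 u (by omega)]; omega
      have haO : a ∉ O := by rw [h1 a (by omega), ha2]; cases s <;> simp
      obtain ⟨b, hb1, hb2⟩ := hexi (m - 2) (!s) (by omega)
      have hbO : b ∉ O := by rw [h1 b (by omega)]; omega
      have hsd : ∀ v, side v = s ∨ side v = !s := by
        intro v; cases side v <;> cases s <;> simp
      have hss : s ≠ !s := by cases s <;> simp
      -- vertices in the last two columns
      have hcl : ∀ v, m - 2 ≤ col v → col v < m → v = u ∨ v = a ∨ v = b ∨ v ∈ O := by
        intro v hv hv'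
        rcases hsd v with hsv | hsv
        · by_cases hc : col v = m - 2
          · left; exact hext _ _ (by omega) (by rw [hsv, hu2])
          · right; left; exact hext _ _ (by omega) (by rw [hsv, ha2])
        · by_cases hc : col v = m - 2
          · right; right; left; exact hext _ _ (by omega) (by rw [hsv, hb2])
          · right; right; right; exact (h1 v hv').2 ⟨by omega, hsv⟩
      have hua : G.Adj u a := by rw [hadj]; right; exact ⟨by rw [hu2, ha2], by omega⟩
      have hub : G.Adj u b := by rw [hadj]; left; exact ⟨by omega, by rw [hu2, hb2]; exact hss⟩
      have hab : ¬ G.Adj a b := by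
        rw [hadj, ha2, hb2]
        rintro (⟨h, _⟩ | ⟨h, _⟩)
        · omega
        · exact hss h
      refine Good.node O u (Finset.univ.filter (G.Adj u)) huO (by simp) ?_ ?_
      · refine (ih (m - 2) (by omega)).1 (j + 1) (!s) _ (by omega) (by omega) ?_ ?_ ?_
        · intro v hv
          have hvO : v ∉ O := by rw [h1 v (by omega)]; omega
          simp only [Finset.mem_union, hvO, false_or, Finset.mem_filter, Finset.mem_univ, true_and,
            hadj, hu1, hu2, Bool.not_not]
          constructor
          · rintro (⟨h, _⟩ | ⟨h, h'⟩)
            · omega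
            · exact ⟨by omega, h.symm⟩
          · rintro ⟨h, h'⟩
            exact Or.inr ⟨h'.symm, by omega⟩
        · intro v w hvw hv
          simp only [Finset.mem_union, Finset.mem_filter, Finset.mem_univ, true_and]
          by_cases hv2 : m ≤ col v
          · rcases h2 v w hvw hv2 with h | h <;> simp [h]
          rcases hcl v hv (by omega) with rfl | rfl | rfl | h
          · exact Or.inr (Or.inr hvw)
          · exact Or.inl (Or.inr hua)
          · exact Or.inl (Or.inr hub)
          · exact Or.inl (Or.inl h)
        · intro k hk
          by_cases hkj : k < j
          · obtain ⟨v, hv, hvm, hc⟩ := h3 k hkj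
            refine ⟨v, ?_, by omega, hc⟩
            simp only [Finset.mem_union, hv, false_or, Finset.mem_filter, Finset.mem_univ,
              true_and, hadj]
            omega
          · refine ⟨u, ?_, by omega, by omega⟩
            simp [huO]
      · refine (ih (m - 2) (by omega)).2 (j + 1) (!s) _ b (by omega) hb1 hb2 (by omega) ?_ ?_ ?_ ?_
        · rw [Finset.mem_insert]
          rintro (h | h)
          · exact irr _ (h ▸ hub)
          · exact hbO h
        · intro v hv
          rw [Finset.mem_insert]
          rintro (h | h)
          · subst h; omega
          · rw [h1 v (by omega)] at h; omega
        · intro v w hvw hv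
          simp only [Finset.mem_insert]
          by_cases hv2 : m ≤ col v
          · rcases h2 v w hvw hv2 with h | h <;> simp [h]
          by_cases hw2 : m ≤ col w
          · rcases h2 w v (hsymm _ _ hvw) hw2 with h | h <;> simp [h]
          by_cases hw3 : m - 2 ≤ col w
          · rcases hcl v hv (by omega) with rfl | rfl | rfl | h
            · simp
            · rcases hcl w hw3 (by omega) with rfl | rfl | rfl | h'
              · simp
              · exact absurd hvw (irr _)
              · exact absurd hvw hab
              · simp [h']
            · rcases hcl w hw3 (by omega) with rfl | rfl | rfl | h'
              · simp
              · exact absurd (hsymm _ _ hvw) hab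
              · exact absurd hvw (irr _)
              · simp [h']
            · simp [h]
          · rcases hcl v hv (by omega) with rfl | rfl | rfl | h
            · simp
            · rw [hadj] at hvw; omega
            · rw [hadj] at hvw
              right; right
              exact ⟨rfl, by omega⟩
            · simp [h]
        · intro k hk
          by_cases hkj : k < j
          · obtain ⟨v, hv, hvm, hc⟩ := h3 k hkj
            refine ⟨v, ?_, ?_, by omega, hc⟩
            · rw [Finset.mem_insert]
              rintro (h | h)
              · subst h; omega
              · exact hv h
            · rintro rfl; omega
          · refine ⟨a, ?_, ?_, by omega, by omega⟩
            · rw [Finset.mem_insert]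
              rintro (h | h)
              · exact irr _ (h ▸ hua)
              · exact haO h
            · rintro rfl; omega
  refine ⟨hP, ?_⟩
  intro j s O z hj hz1 hz2 hmn hzO h1 h2 h3
  have hsd : ∀ v, side v = s ∨ side v = !s := by
    intro v; cases side v <;> cases s <;> simp
  have hss : s ≠ !s := by cases s <;> simp
  rcases Nat.eq_zero_or_pos m with hm | hm
  · refine Good.leaf O ?_ ?_
    · intro v w hvw
      rcases h2 v w hvw (by omega) with h | h | ⟨_, h⟩
      · exact Or.inl h
      · exact Or.inr h
      · omega
    · intro k hk
      obtain ⟨v, hv, _, _, hc⟩ := h3 k (by omega)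
      exact ⟨v, hv, hc⟩
  obtain ⟨u, hu1, hu2⟩ := hexi (m - 1) s (by omega)
  obtain ⟨a, ha1, ha2⟩ := hexi (m - 1) (!s) (by omega)
  have huO : u ∉ O := h1 u (by omega)
  have haO : a ∉ O := h1 a (by omega)
  have hua : G.Adj u a := by rw [hadj]; left; exact ⟨by omega, by rw [hu2, ha2]; exact hss⟩
  have huz : G.Adj u z := by rw [hadj]; right; exact ⟨by rw [hu2, hz2], by omega⟩
  have hcl : ∀ v, col v + 1 = m → v = u ∨ v = a := by
    intro v hv
    rcases hsd v with hsv | hsv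
    · left; exact hext _ _ (by omega) (by rw [hsv, hu2])
    · right; exact hext _ _ (by omega) (by rw [hsv, ha2])
  -- old edges stay covered once `u` or `z` is handled
  have hzw : ∀ w, G.Adj z w → col w + 1 = m → w = u := by
    intro w h hw
    rcases hcl w hw with h' | rfl
    · exact h'
    · rw [hadj, hz2, ha2] at h
      rcases h with ⟨h, _⟩ | ⟨h, _⟩
      · omega
      · exact absurd h hss
  refine Good.node O u (Finset.univ.filter (G.Adj u)) huO (by simp) ?_ ?_
  · have hO : ∀ v, v ∈ O ∪ Finset.univ.filter (G.Adj u) ↔ v ∈ O ∨ G.Adj u v := by simp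
    have h3' : ∀ k < j, ∃ v, v ∉ O ∪ Finset.univ.filter (G.Adj u) ∧ m ≤ col v ∧
        (n - col v) / 2 = k := by
      intro k hk
      obtain ⟨v, hv, hvz, hvm, hc⟩ := h3 k hk
      refine ⟨v, ?_, hvm, hc⟩
      rw [hO]
      rintro (h | h)
      · exact hv h
      · rw [hadj, hu2] at h
        rcases h with ⟨h, _⟩ | ⟨h, h'⟩
        · omega
        · exact hvz (hext _ _ (by omega) (by rw [← h, hz2]))
    have huO' : u ∉ O ∪ Finset.univ.filter (G.Adj u) := by
      rw [hO]; rintro (h | h)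
      · exact huO h
      · exact irr _ h
    have hcov : ∀ v w, G.Adj v w → m - 1 ≤ col v →
        v ∈ O ∪ Finset.univ.filter (G.Adj u) ∨ w ∈ O ∪ Finset.univ.filter (G.Adj u) := by
      intro v w hvw hv
      simp only [hO]
      by_cases hv2 : m ≤ col v
      · rcases h2 v w hvw hv2 with h | h | ⟨rfl, h⟩
        · simp [h]
        · simp [h]
        · exact Or.inl (Or.inr huz)
      · rcases hcl v (by omega) with rfl | rfl
        · exact Or.inr (Or.inr hvw)
        · exact Or.inl (Or.inr hua)
    by_cases hm1 : m = 1
    · refine Good.leaf _ (fun v w h => hcov v w h (by omega)) ?_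
      intro k hk
      by_cases hkj : k < j
      · obtain ⟨v, hv, _, hc⟩ := h3' k hkj
        exact ⟨v, hv, hc⟩
      · refine ⟨u, huO', ?_⟩
        show (n - col u) / 2 = k
        omega
    obtain ⟨y, hy1, hy2⟩ := hexi (m - 2) s (by omega)
    obtain ⟨x, hx1, hx2⟩ := hexi (m - 2) (!s) (by omega)
    have huy : G.Adj u y := by rw [hadj]; right; exact ⟨by rw [hu2, hy2], by omega⟩
    have hux : ¬ G.Adj u x := by
      rw [hadj, hu2, hx2]
      rintro (⟨h, _⟩ | ⟨h, _⟩)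
      · omega
      · exact hss h
    have hcl2 : ∀ v, col v = m - 2 → v = y ∨ v = x := by
      intro v hv
      rcases hsd v with hsv | hsv
      · left; exact hext _ _ (by omega) (by rw [hsv, hy2])
      · right; exact hext _ _ (by omega) (by rw [hsv, hx2])
    refine (ih (m - 2) (by omega)).2 (j + 1) (!s) _ x (by omega) hx1 hx2 (by omega) ?_ ?_ ?_ ?_
    · rw [hO]; rintro (h | h)
      · exact h1 x (by omega) h
      · exact hux h
    · intro v hv
      rw [hO]; rintro (h | h)
      · exact h1 v (by omega) h
      · rw [hadj] at h; omega
    · intro v w hvw hv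
      by_cases hv2 : m - 1 ≤ col v
      · rcases hcov v w hvw hv2 with h | h <;> simp only [h, true_or, or_true]
      by_cases hw2 : m - 1 ≤ col w
      · rcases hcov w v (hsymm _ _ hvw) hw2 with h | h <;> simp only [h, true_or, or_true]
      simp only [hO]
      rcases hcl2 v (by omega) with rfl | rfl
      · exact Or.inl (Or.inr huy)
      · by_cases hw3 : col w = m - 2
        · rcases hcl2 w hw3 with rfl | rfl
          · exact Or.inr (Or.inl (Or.inr huy))
          · exact absurd hvw (irr _)
        · right; right
          rw [hadj] at hvw
          exact ⟨rfl, by omega⟩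
    · intro k hk
      by_cases hkj : k < j
      · obtain ⟨v, hv, hvm, hc⟩ := h3' k hkj
        exact ⟨v, hv, by rintro rfl; omega, by omega, hc⟩
      · exact ⟨u, huO', by rintro rfl; omega, by omega, by omega⟩
  · refine hP j (!s) _ hj (by omega) ?_ ?_ ?_
    · intro v hv
      have hvO := h1 v hv
      simp only [Finset.mem_insert, hvO, or_false, Bool.not_not]
      constructor
      · rintro rfl; exact ⟨by omega, hu2⟩
      · rintro ⟨h, h'⟩
        exact hext _ _ (by omega) (by rw [h', hu2])
    · intro v w hvw hv
      simp only [Finset.mem_insert]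
      rcases h2 v w hvw hv with h | h | ⟨rfl, h⟩
      · simp [h]
      · simp [h]
      · exact Or.inr (Or.inl (hzw w hvw h))
    · intro k hk
      obtain ⟨v, hv, hvz, hvm, hc⟩ := h3 k hk
      refine ⟨v, ?_, hvm, hc⟩
      rw [Finset.mem_insert]
      rintro (h | h)
      · subst h; omega
      · exact hv h

set_option maxHeartbeats 2000000 in
/-- A small maximal independent set. -/
lemma ladder_indep {G : SimpleGraph V} {n : ℕ} (hn : 2 ≤ n) {col : V → ℕ} {side : V → Bool}
    (H : LadderLike G n col side) :
    ∃ W : Finset V, (∀ i ∈ W, ∀ j ∈ W, ¬ G.Adj i j) ∧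
      (∀ v, v ∉ W → ∃ w ∈ W, G.Adj v w) ∧ W.card ≤ n / 2 + 1 := by
  classical
  obtain ⟨hext, hexi, hbd, hadj⟩ := H
  have hpar : n % 2 = 0 ∨ n % 2 = 1 := by omega
  obtain ⟨p, hp⟩ : ∃ p : ℕ → Bool → Prop, ∀ i s, p i s ↔
      (i < n ∧ ((n % 2 = 1 ∧ (n - 1 - i) % 2 = 0 ∧ (s = true ↔ (n - 1 - i) % 4 = 0)) ∨
      (n % 2 = 0 ∧ ((i + 1 = n ∧ s = true) ∨
        ((n - 1 - i) % 2 = 1 ∧ (s = true ↔ (n - 1 - i) % 4 = 3)))))) :=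
    ⟨_, fun _ _ => Iff.rfl⟩
  have hW : ∀ v, v ∈ Finset.univ.filter (fun v => p (col v) (side v)) ↔ p (col v) (side v) := by
    simp
  refine ⟨Finset.univ.filter (fun v => p (col v) (side v)), ?_, ?_, ?_⟩
  · intro i hi j hj
    rw [hW, hp] at hi hj
    rw [hadj]
    rcases hpar with hpar | hpar <;> cases hsi : side i <;> cases hsj : side j <;>
      simp [hsi, hsj, hpar] at hi hj ⊢ <;> omega
  · intro v hv
    rw [hW, hp] at hv
    have key : ∃ i s, p i s ∧ ((col v = i ∧ side v ≠ s) ∨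
        (side v = s ∧ (col v + 1 = i ∨ i + 1 = col v))) := by
      have hb := hbd v
      by_cases c0 : col v = n
      · exact ⟨n - 1, true, (hp _ _).2 (by
          simp only [true_iff, and_true]; omega), by
          right
          refine ⟨?_, by omega⟩
          rcases hb with h | h
          · omega
          · exact h.2⟩
      have c0' : col v < n := by omega
      by_cases c1 : (n % 2 = 1 ∧ (n - 1 - col v) % 2 = 0) ∨
          (n % 2 = 0 ∧ ((n - 1 - col v) % 2 = 1 ∨ col v + 1 = n))
      · refine ⟨col v, !side v, (hp _ _).2 ?_, by left; simp⟩
        rcases hpar with hpar | hpar <;> cases hsv : side v <;>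
          simp [hsv, hpar, c0'] at hv c1 ⊢ <;> omega
      · by_cases c2 : p (col v + 1) (side v)
        · exact ⟨_, _, c2, by right; simp⟩
        · refine ⟨col v - 1, side v, (hp _ _).2 ?_, by right; exact ⟨rfl, by omega⟩⟩
          rw [hp] at c2
          rcases hpar with hpar | hpar <;> cases hsv : side v <;>
            simp [hsv, hpar, c0'] at hv c1 c2 ⊢ <;> omega
    obtain ⟨i, s, h1, h2⟩ := key
    obtain ⟨w, hw1, hw2⟩ := hexi i s (Or.inl ((hp i s).1 h1).1)
    refine ⟨w, ?_, ?_⟩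
    · rw [hW, hw1, hw2]; exact h1
    · rw [hadj, hw1, hw2]; exact h2
  · have hc : ((Finset.univ.filter (fun v => p (col v) (side v))).card) ≤
        (Finset.range (n / 2 + 1)).card := by
      refine Finset.card_le_card_of_injOn (fun v => (n - col v) / 2) ?_ ?_
      · intro v _
        simp only [Finset.coe_range, Set.mem_Iio]
        omega
      · intro v hv w hw h
        rw [Finset.mem_coe, hW, hp] at hv hw
        simp only at h
        have h1 : col v = col w := by
          rcases hpar with hpar | hpar <;> simp [hpar] at hv hw <;> omega
        refine hext v w h1 ?_
        rcases hpar with hpar | hpar <;> cases hsi : side v <;> cases hsj : side w <;>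
          simp [hsi, hsj, hpar] at hv hw ⊢ <;> omega
    simpa using hc

end Part4
section Part5

def colB {n : ℕ} : Fin n ⊕ Fin (n + 1) → ℕ
  | .inl i => i
  | .inr i => i

def sideB {n : ℕ} : Fin n ⊕ Fin (n + 1) → Bool
  | .inl _ => false
  | .inr _ => true

lemma graphB_ladder (n : ℕ) : LadderLike (graphB n) n colB sideB where
  ext := by
    rintro (i | i) (j | j) h h' <;> simp [colB, sideB, Fin.ext_iff] at h h' ⊢ <;> exact h
  exi := by
    rintro i (_ | _) h
    · refine ⟨.inl ⟨i, by simpa using h⟩, rfl, rfl⟩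
    · refine ⟨.inr ⟨i, by omega⟩, rfl, rfl⟩
  bd := by
    rintro (i | i)
    · left; exact i.2
    · have := i.2
      simp only [colB, sideB, and_true]
      omega
  adj := by
    rintro (i | i) (j | j) <;> simp [graphB, SimpleGraph.fromRel_adj, colB, sideB, Fin.ext_iff] <;>
      omega

lemma graphB_good (n : ℕ) :
    Good (graphB n) (fun v => (n - colB v) / 2) (n / 2 + 1) ∅ := by
  refine (ladder_good (graphB_ladder n) (n + 1)).1 0 true ∅ (by omega) (fun _ => rfl) ?_ ?_ ?_
  · intro v hv
    have := (graphB_ladder n).bd v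
    simp only [Finset.notMem_empty, false_iff]
    rintro ⟨h1, h2⟩
    rcases this with h | ⟨_, h⟩
    · omega
    · rw [h] at h2; simp at h2
  · intro v w _ hv
    have := (graphB_ladder n).bd v
    omega
  · intro k hk; omega

end Part5

theorem depth_sdepth_graphB (n : ℕ) (hn : 2 ≤ n) (K : Type*) [Field K] :
    depthQuot (edgeIdeal K (graphB n)) = ⌈((n : ℚ) + 1) / 2⌉₊ ∧
    sdepthQuot (edgeIdeal K (graphB n)) = ⌈((n : ℚ) + 1) / 2⌉₊ := by
  have hceil : ⌈((n : ℚ) + 1) / 2⌉₊ = n / 2 + 1 := by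
    rw [Nat.ceil_eq_iff (by omega)]
    have h : n = 2 * (n / 2) + n % 2 := by omega
    have h2 : n % 2 < 2 := by omega
    have h' : (n : ℚ) = 2 * ((n / 2 : ℕ) : ℚ) + ((n % 2 : ℕ) : ℚ) := by exact_mod_cast h
    have h0 : (0 : ℚ) ≤ ((n % 2 : ℕ) : ℚ) := by positivity
    have h1 : ((n % 2 : ℕ) : ℚ) ≤ 1 := by exact_mod_cast (by omega : n % 2 ≤ 1)
    rw [Nat.add_sub_cancel]
    rw [Nat.cast_add, Nat.cast_one]
    constructor <;> linarith
  obtain ⟨W, hW1, hW2, hW3⟩ := ladder_indep hn (graphB_ladder n)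
  rw [hceil]
  constructor
  · refine IsGreatest.csSup_eq ⟨depth_lower (graphB_good n), ?_⟩
    rintro _ ⟨rs, rfl, hrs, hreg⟩
    exact (depth_upper (graphB n) W hW1 hW2 rs hrs hreg).trans hW3
  · refine IsGreatest.csSup_eq ⟨sdepth_lower (graphB_good n), ?_⟩
    rintro k ⟨D, hD⟩
    exact (sdepth_upper (graphB n) W hW1 hW2 D k hD).trans hW3
end

section
/- Let n ≥ 2, let K be a field, let B_n be the graph obtained from the ladder graph A_n by adjoining one new vertex y_{n+1} together with the edge {y_n, y_{n+1}}, and let S = K[V(B_n)]. Then the projective dimension of S/I(B_n) as an S-module equals 2n − ⌈(n+1)/2⌉ + 1. -/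
open MvPolynomial

/-! ### Comparison with Mathlib's projective dimension -/

namespace PdimAux

open CategoryTheory

universe u

theorem pdimLE_iff {R : Type u} [CommRing R] (n : ℕ) (M : Type u) [AddCommGroup M] [Module R M] :
    pdimLE R n M ↔ HasProjectiveDimensionLE (ModuleCat.of R M) n := by
  induction n generalizing M with
  | zero =>
    rw [← projective_iff_hasProjectiveDimensionLE_zero, ← IsProjective.iff_projective]
    rfl
  | succ n ih =>
    constructor
    · rintro ⟨P, _, _, f, hP, hf, hk⟩
      have hS := LinearMap.shortExact_shortComplexKer hf
      rw [ih] at hk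
      have hP' : Projective f.shortComplexKer.X₂ := (IsProjective.iff_projective P).mp hP
      exact (hS.hasProjectiveDimensionLT_X₃_iff n hP').mpr hk
    · intro h
      let f : (M →₀ R) →ₗ[R] M := Finsupp.linearCombination R id
      have hf : Function.Surjective f := Finsupp.linearCombination_id_surjective R M
      have hS := LinearMap.shortExact_shortComplexKer hf
      have hP' : Projective f.shortComplexKer.X₂ :=
        (IsProjective.iff_projective (M →₀ R)).mp inferInstance
      refine ⟨(M →₀ R), inferInstance, inferInstance, f, inferInstance, hf, ?_⟩
      rw [ih]
      exact (hS.hasProjectiveDimensionLT_X₃_iff n hP').mp h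

/-- `pd S/J < n` -/
def PdLT {R : Type u} [CommRing R] (J : Ideal R) (n : ℕ) : Prop :=
  HasProjectiveDimensionLT (ModuleCat.of R (R ⧸ J)) n

theorem PdLT.mono {R : Type u} [CommRing R] {J : Ideal R} {n m : ℕ} (h : PdLT J n) (hnm : n ≤ m) :
    PdLT J m := by
  unfold PdLT at *
  exact hasProjectiveDimensionLT_of_ge _ n m hnm

/-- The multiplication map `S/(J:x) → S/J`. -/
noncomputable def mulMap {R : Type u} [CommRing R] (J J' : Ideal R) (x : R)
    (h : ∀ f, x * f ∈ J ↔ f ∈ J') : (R ⧸ J') →ₗ[R] (R ⧸ J) :=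
  Submodule.mapQ J' J (LinearMap.mulLeft R x) (fun f hf => (h f).mpr hf)

theorem shortExact_colon {R : Type u} [CommRing R] (J J' : Ideal R) (x : R)
    (h : ∀ f, x * f ∈ J ↔ f ∈ J') :
    ∃ T : ShortComplex (ModuleCat.{u} R), T.ShortExact ∧ T.X₁ = ModuleCat.of R (R ⧸ J') ∧
      T.X₂ = ModuleCat.of R (R ⧸ J) ∧
      T.X₃ = ModuleCat.of R (R ⧸ (J ⊔ Ideal.span {x})) := by
  let f := mulMap J J' x h
  let g : (R ⧸ J) →ₗ[R] (R ⧸ (J ⊔ Ideal.span {x})) :=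
    Submodule.mapQ J (J ⊔ Ideal.span {x}) LinearMap.id (fun y hy => Ideal.mem_sup_left hy)
  have hz : g.comp f = 0 := by
    apply LinearMap.ext
    intro y
    obtain ⟨y, rfl⟩ := Submodule.Quotient.mk_surjective _ y
    change Submodule.Quotient.mk (x * y) = (0 : R ⧸ (J ⊔ Ideal.span {x}))
    rw [Submodule.Quotient.mk_eq_zero]
    exact Ideal.mem_sup_right (Ideal.mul_mem_right _ _ (Ideal.mem_span_singleton_self x))
  refine ⟨ModuleCat.shortComplexOfCompEqZero f g hz, ?_, rfl, rfl, rfl⟩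
  have hinj : Function.Injective f := by
    rw [injective_iff_map_eq_zero]
    intro y hy
    obtain ⟨y, rfl⟩ := Submodule.Quotient.mk_surjective _ y
    change Submodule.Quotient.mk (x * y) = (0 : R ⧸ J) at hy
    rw [Submodule.Quotient.mk_eq_zero] at hy
    rw [Submodule.Quotient.mk_eq_zero]
    exact (h y).mp hy
  have hsurj : Function.Surjective g := by
    intro y
    obtain ⟨y, rfl⟩ := Submodule.Quotient.mk_surjective _ y
    exact ⟨Submodule.Quotient.mk y, rfl⟩
  have hex : Function.Exact f g := by
    intro y
    constructor
    · intro hy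
      obtain ⟨y, rfl⟩ := Submodule.Quotient.mk_surjective _ y
      change Submodule.Quotient.mk y = (0 : R ⧸ (J ⊔ Ideal.span {x})) at hy
      rw [Submodule.Quotient.mk_eq_zero] at hy
      obtain ⟨a, ha, b, hb, rfl⟩ := Submodule.mem_sup.mp hy
      obtain ⟨c, rfl⟩ := Ideal.mem_span_singleton'.mp hb
      refine ⟨Submodule.Quotient.mk c, ?_⟩
      change (Submodule.Quotient.mk (x * c) : R ⧸ J) = _
      rw [Submodule.Quotient.eq]
      have : x * c - (a + c * x) = -a := by ring
      rw [this]
      exact neg_mem ha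
    · rintro ⟨z, rfl⟩
      exact LinearMap.congr_fun hz z
  exact
    { exact := (ShortComplex.ShortExact.moduleCat_exact_iff_function_exact _).mpr hex
      mono_f := (ModuleCat.mono_iff_injective _).mpr hinj
      epi_g := (ModuleCat.epi_iff_surjective _).mpr hsurj }

theorem PdLT.of_colon {R : Type u} [CommRing R] {J J' : Ideal R} {x : R} {n : ℕ}
    (h : ∀ f, x * f ∈ J ↔ f ∈ J') (h1 : PdLT J' n) (h2 : PdLT (J ⊔ Ideal.span {x}) n) :
    PdLT J n := by
  obtain ⟨T, hT, e1, e2, e3⟩ := shortExact_colon J J' x h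
  unfold PdLT at *
  rw [← e1] at h1
  rw [← e3] at h2
  rw [← e2]
  exact hT.hasProjectiveDimensionLT_X₂ n h1 h2

theorem PdLT.sup_span {R : Type u} [CommRing R] {J : Ideal R} {x : R} {n : ℕ}
    (h : ∀ f, x * f ∈ J ↔ f ∈ J) (h1 : PdLT J n) : PdLT (J ⊔ Ideal.span {x}) (n + 1) := by
  obtain ⟨T, hT, e1, e2, e3⟩ := shortExact_colon J J x h
  have h2 := h1.mono (Nat.le_succ n)
  unfold PdLT at *
  rw [← e1] at h1
  rw [← e2] at h2
  rw [← e3]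
  exact hT.hasProjectiveDimensionLT_X₃ n h1 h2

theorem PdLT.bot {R : Type u} [CommRing R] : PdLT (⊥ : Ideal R) 1 := by
  unfold PdLT
  rw [← projective_iff_hasProjectiveDimensionLT_one, ← IsProjective.iff_projective]
  exact Module.Projective.of_equiv (Submodule.quotEquivOfEqBot (⊥ : Ideal R) rfl).symm

/-! ### The ideals `I(G) + (x_u : u ∈ U)` -/

variable {K : Type u} [Field K] {V : Type}

/-- `I(G) + (X_u : u ∈ U)` -/
noncomputable def killIdeal (K : Type u) [Field K] (G : SimpleGraph V) (U : Set V) :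
    Ideal (MvPolynomial V K) :=
  edgeIdeal K G ⊔ Ideal.span (X '' U)

theorem mem_killIdeal (G : SimpleGraph V) (U : Set V) (f : MvPolynomial V K) :
    f ∈ killIdeal K G U ↔ ∀ m ∈ f.support, (∃ u ∈ U, m u ≠ 0) ∨
      ∃ i j, G.Adj i j ∧ m i ≠ 0 ∧ m j ≠ 0 := by
  classical
  have : killIdeal K G U = Ideal.span ((fun s => monomial s (1 : K)) ''
      ({s | ∃ u ∈ U, s = Finsupp.single u 1} ∪
        {s | ∃ i j, G.Adj i j ∧ s = Finsupp.single i 1 + Finsupp.single j 1})) := by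
    rw [killIdeal, edgeIdeal, ← Ideal.span_union]
    congr 1
    ext p
    constructor
    · rintro (⟨i, j, hij, rfl⟩ | ⟨u, hu, rfl⟩)
      · exact ⟨_, Or.inr ⟨i, j, hij, rfl⟩, by simp [X, monomial_mul]⟩
      · exact ⟨_, Or.inl ⟨u, hu, rfl⟩, rfl⟩
    · rintro ⟨s, (⟨u, hu, rfl⟩ | ⟨i, j, hij, rfl⟩), rfl⟩
      · exact Or.inr ⟨u, hu, rfl⟩
      · exact Or.inl ⟨i, j, hij, by simp [X, monomial_mul]⟩
  rw [this, mem_ideal_span_monomial_image]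
  refine forall₂_congr fun m _ => ?_
  constructor
  · rintro ⟨s, (⟨u, hu, rfl⟩ | ⟨i, j, hij, rfl⟩), hs⟩
    · left
      refine ⟨u, hu, ?_⟩
      have := hs u
      simp at this
      omega
    · right
      refine ⟨i, j, hij, ?_, ?_⟩
      · have := hs i
        simp at this
        omega
      · have := hs j
        simp at this
        omega
  · rintro (⟨u, hu, h⟩ | ⟨i, j, hij, hi, hj⟩)
    · refine ⟨_, Or.inl ⟨u, hu, rfl⟩, ?_⟩
      simpa [Nat.one_le_iff_ne_zero] using h
    · refine ⟨_, Or.inr ⟨i, j, hij, rfl⟩, ?_⟩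
      intro v
      have hne := hij.ne
      simp only [Finsupp.add_apply, Finsupp.single_apply]
      split_ifs with h1 h2
      · subst h1; exact absurd h2.symm hne
      · subst h1; omega
      · rename_i h2
        subst h2; omega
      · omega

theorem killIdeal_insert (G : SimpleGraph V) (U : Set V) (x : V) :
    killIdeal K G (insert x U) = killIdeal K G U ⊔ Ideal.span {X x} := by
  rw [killIdeal, killIdeal, Set.image_insert_eq, Ideal.span_insert, sup_assoc,
    sup_comm (Ideal.span {X x})]

theorem colon_killIdeal (G : SimpleGraph V) (U : Set V) (x : V) (hx : x ∉ U)
    (f : MvPolynomial V K) :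
    X x * f ∈ killIdeal K G U ↔ f ∈ killIdeal K G (U ∪ G.neighborSet x) := by
  classical
  rw [mem_killIdeal, mem_killIdeal, support_X_mul]
  simp only [Finset.mem_map, addLeftEmbedding_apply, forall_exists_index, and_imp,
    forall_apply_eq_imp_iff₂]
  refine forall₂_congr fun m _ => ?_
  simp only [Finsupp.add_apply, Set.mem_union, SimpleGraph.mem_neighborSet]
  constructor
  · rintro (⟨u, hu, h⟩ | ⟨i, j, hij, hi, hj⟩)
    · left
      refine ⟨u, Or.inl hu, ?_⟩
      have : x ≠ u := fun h => hx (h ▸ hu)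
      simpa [Finsupp.single_apply, this] using h
    · by_cases h1 : x = i
      · subst h1
        left
        exact ⟨j, Or.inr hij, by simpa [Finsupp.single_apply, hij.ne] using hj⟩
      · by_cases h2 : x = j
        · subst h2
          left
          exact ⟨i, Or.inr hij.symm, by simpa [Finsupp.single_apply, h1] using hi⟩
        · right
          exact ⟨i, j, hij, by simpa [Finsupp.single_apply, h1] using hi,
            by simpa [Finsupp.single_apply, h2] using hj⟩
  · rintro (⟨u, (hu | hu), h⟩ | ⟨i, j, hij, hi, hj⟩)
    · left
      exact ⟨u, hu, by omega⟩
    · right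
      exact ⟨x, u, hu, by simp, by omega⟩
    · right
      exact ⟨i, j, hij, by omega, by omega⟩

theorem pd_branch (G : SimpleGraph V) (U : Set V) (x : V) (n : ℕ)
    (h1 : PdLT (killIdeal K G (U ∪ G.neighborSet x)) n)
    (h2 : PdLT (killIdeal K G (insert x U)) n) : PdLT (killIdeal K G U) n := by
  by_cases hx : x ∈ U
  · rwa [Set.insert_eq_of_mem hx] at h2
  · rw [killIdeal_insert] at h2
    exact PdLT.of_colon (colon_killIdeal G U x hx) h1 h2

theorem mul_X_mem_span (U : Set V) (x : V) (hx : x ∉ U) (f : MvPolynomial V K) :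
    X x * f ∈ Ideal.span (X '' U : Set (MvPolynomial V K)) ↔
      f ∈ Ideal.span (X '' U : Set (MvPolynomial V K)) := by
  have e : ∀ W : Set V, killIdeal K (⊥ : SimpleGraph V) W = Ideal.span (X '' W) := by
    intro W
    simp [killIdeal, edgeIdeal]
  have := colon_killIdeal (K := K) ⊥ U x hx f
  have hn : (⊥ : SimpleGraph V).neighborSet x = ∅ := by ext; simp
  rwa [hn, Set.union_empty, e] at this

theorem pd_span (U : Finset V) :
    PdLT (Ideal.span (X '' (U : Set V) : Set (MvPolynomial V K))) (U.card + 1) := by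
  classical
  induction U using Finset.induction_on with
  | empty =>
    have : Ideal.span (X '' ((∅ : Finset V) : Set V) : Set (MvPolynomial V K)) = ⊥ := by simp
    rw [this]
    exact PdLT.bot
  | insert x U hx ih =>
    rw [Finset.card_insert_of_notMem hx, Finset.coe_insert, Set.image_insert_eq, Ideal.span_insert,
      sup_comm]
    exact PdLT.sup_span (mul_X_mem_span _ _ (by simpa using hx)) ih

theorem pd_cover (G : SimpleGraph V) (U : Finset V) (hU : ∀ i j, G.Adj i j → i ∈ U ∨ j ∈ U) :
    PdLT (killIdeal K G (U : Set V)) (U.card + 1) := by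
  have : killIdeal K G (U : Set V) = Ideal.span (X '' (U : Set V)) := by
    rw [killIdeal, sup_eq_right, edgeIdeal, Ideal.span_le]
    rintro _ ⟨i, j, hij, rfl⟩
    rcases hU i j hij with h | h
    · exact Ideal.mul_mem_right _ _ (Ideal.subset_span ⟨i, h, rfl⟩)
    · exact Ideal.mul_mem_left _ _ (Ideal.subset_span ⟨j, h, rfl⟩)
  rw [this]
  exact pd_span U

/-! ### Upper bound for ladder-like graphs -/

theorem pd_ladder_upper (G : SimpleGraph V) (p : V → Bool × ℕ) (hp : Function.Injective p)
    (hadj : ∀ a b, G.Adj a b ↔ ((p a).1 = (p b).1 ∧ ((p a).2 + 1 = (p b).2 ∨ (p b).2 + 1 = (p a).2))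
      ∨ ((p a).1 ≠ (p b).1 ∧ (p a).2 = (p b).2))
    (n : ℕ) (hex : ∀ s, ∀ i < n, ∃ v, p v = (s, i)) :
    ∀ m, m ≤ n → ∀ (s : Bool) (U : Finset V),
      (∀ a b, G.Adj a b → a ∉ U → b ∉ U → (p a).2 < m ∨ ((p a).1 = s ∧ (p a).2 = m)) →
      PdLT (killIdeal K G (U : Set V)) (U.card + 2 * m - m / 2 + 1) := by
  classical
  intro m
  induction m using Nat.strong_induction_on with
  | _ m ih =>
    intro hmn s U hU
    rcases Nat.eq_zero_or_pos m with rfl | hm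
    · refine (pd_cover G U ?_).mono (by omega)
      intro a b hab
      by_contra hcon
      push Not at hcon
      have h1 := hU a b hab hcon.1 hcon.2
      have h2 := hU b a hab.symm hcon.2 hcon.1
      have : a = b := hp (Prod.ext (by rcases h1 with h1 | h1 <;> rcases h2 with h2 | h2 <;>
        first | omega | (rw [h1.1, h2.1])) (by omega))
      exact hab.ne this
    · obtain ⟨x, hx⟩ := hex s (m - 1) (by omega)
      -- the candidates for the neighbours of `x`
      have hNfin : (G.neighborSet x).Finite := by
        refine Set.Finite.of_finite_image (f := p) (Set.Finite.subset
          (Finset.finite_toSet {(s, m), (s, m - 2), (!s, m - 1)}) ?_) hp.injOn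
        rintro _ ⟨y, hy, rfl⟩
        have := (hadj x y).mp hy
        rw [hx] at this
        rcases hq : p y with ⟨t, k⟩
        rw [hq] at this
        simp only at this
        simp only [Finset.coe_insert, Finset.coe_singleton, Set.mem_insert_iff,
          Set.mem_singleton_iff, Prod.mk.injEq]
        rcases this with ⟨h1, h2 | h2⟩ | ⟨h1, h2⟩
        · left; exact ⟨h1.symm, by omega⟩
        · right; left; exact ⟨h1.symm, by omega⟩
        · right; right; exact ⟨Bool.eq_not.mpr (Ne.symm h1), h2.symm⟩
      set N : Finset V := hNfin.toFinset with hN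
      have hNmem : ∀ y, y ∈ N ↔ G.Adj x y := by intro y; simp [hN]
      have hUN : (U : Set V) ∪ G.neighborSet x = ((U ∪ N : Finset V) : Set V) := by
        ext y; simp [hNmem]
      have hUi : insert x (U : Set V) = ((insert x U : Finset V) : Set V) := by
        ext y; simp
      -- membership in N
      have hNim : N.image p ⊆ {(s, m), (s, m - 2), (!s, m - 1)} ∧
          (m = 1 → N.image p ⊆ {(s, m), (!s, m - 1)}) := by
        have key : ∀ y ∈ N, p y = (s, m) ∨ (p y = (s, m - 2) ∧ 2 ≤ m) ∨ p y = (!s, m - 1) := by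
          intro y hy
          have := (hadj x y).mp ((hNmem y).mp hy)
          rw [hx] at this
          rcases hq : p y with ⟨t, k⟩
          rw [hq] at this
          simp only at this
          simp only [Prod.mk.injEq]
          rcases this with ⟨h1, h2 | h2⟩ | ⟨h1, h2⟩
          · left; exact ⟨h1.symm, by omega⟩
          · right; left; exact ⟨⟨h1.symm, by omega⟩, by omega⟩
          · right; right; exact ⟨Bool.eq_not.mpr (Ne.symm h1), h2.symm⟩
        constructor
        · intro q hq
          obtain ⟨y, hy, rfl⟩ := Finset.mem_image.mp hq
          simp only [Finset.mem_insert, Finset.mem_singleton]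
          rcases key y hy with h | h | h
          · exact Or.inl h
          · exact Or.inr (Or.inl h.1)
          · exact Or.inr (Or.inr h)
        · intro hm1 q hq
          obtain ⟨y, hy, rfl⟩ := Finset.mem_image.mp hq
          simp only [Finset.mem_insert, Finset.mem_singleton]
          rcases key y hy with h | h | h
          · exact Or.inl h
          · omega
          · exact Or.inr h
      have hNcard : N.card ≤ 3 := by
        rw [← Finset.card_image_of_injective N hp]
        exact (Finset.card_le_card hNim.1).trans Finset.card_le_three
      have hNcard1 : m = 1 → N.card ≤ 2 := by
        intro h
        rw [← Finset.card_image_of_injective N hp]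
        exact (Finset.card_le_card (hNim.2 h)).trans Finset.card_le_two
      have hcard := Finset.card_union_le U N
      have hcardi := Finset.card_insert_le x U
      -- surviving vertices after deleting the neighbourhood of `x`
      have hsurv : ∀ a b, G.Adj a b → a ∉ U ∪ N → b ∉ U ∪ N →
          (p a).2 + 2 < m ∨ ((p a).1 = (!s) ∧ (p a).2 + 2 = m) := by
        intro a b hab ha hb
        simp only [Finset.mem_union, not_or, hNmem] at ha hb
        have h0 := hU a b hab ha.1 hb.1
        have hax : a ≠ x := fun h => hb.2 (h ▸ hab)
        have hax' : ¬ ((p a).1 = s ∧ (p a).2 = m - 1) := by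
          rintro ⟨h1, h2⟩
          exact hax (hp (by rw [hx]; exact Prod.ext h1 h2))
        have hnadj := ha.2
        rw [hadj, hx] at hnadj
        simp only at hnadj
        by_cases hs : (p a).1 = s
        · rw [hs] at hnadj h0 hax'
          simp only [true_and, ne_eq, not_true_eq_false, false_and, or_false] at hnadj h0 hax'
          left
          omega
        · have hs' : (p a).1 = !s := Bool.eq_not.mpr hs
          have hs2 : s ≠ (p a).1 := fun h => hs h.symm
          simp only [hs, hs2, hs2.symm, false_and, ne_eq, not_false_eq_true, true_and, false_or,
            or_false] at hnadj h0
          rcases Nat.lt_or_ge ((p a).2 + 2) m with h | h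
          · left; exact h
          · right; exact ⟨hs', by omega⟩
      apply pd_branch G (U : Set V) x
      · rw [hUN]
        rcases Nat.lt_or_ge m 2 with hm2 | hm2
        · have hm1 : m = 1 := by omega
          have := hNcard1 hm1
          refine (pd_cover G (U ∪ N) ?_).mono (by omega)
          intro a b hab
          by_contra hcon
          push Not at hcon
          have h1 := hsurv a b hab hcon.1 hcon.2
          omega
        · refine (ih (m - 2) (by omega) (by omega) (!s) (U ∪ N) ?_).mono (by omega)
          intro a b hab ha hb
          rcases hsurv a b hab ha hb with h | h
          · left; omega
          · right; exact ⟨h.1, by omega⟩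
      · rw [hUi]
        refine (ih (m - 1) (by omega) (by omega) (!s) (insert x U) ?_).mono (by omega)
        intro a b hab ha hb
        simp only [Finset.mem_insert, not_or] at ha hb
        have h0 := hU a b hab ha.2 hb.2
        have h0' := hU b a hab.symm hb.2 ha.2
        have hne : ∀ c, c ≠ x → ¬ ((p c).1 = s ∧ (p c).2 = m - 1) := by
          rintro c hc ⟨h1, h2⟩
          exact hc (hp (by rw [hx]; exact Prod.ext h1 h2))
        have hax := hne a ha.1
        have hbx := hne b hb.1
        have hab' := (hadj a b).mp hab
        by_cases hs : (p a).1 = s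
        · left
          rw [hs] at hab' h0 hax
          simp only [true_and] at h0 hax
          by_cases ht : (p b).1 = s
          · rw [ht] at hab' h0' hbx
            simp only [true_and, ne_eq, not_true_eq_false, false_and, or_false] at hab' h0' hbx
            omega
          · have ht2 : s ≠ (p b).1 := fun h => ht h.symm
            simp only [ht, ht2, false_and, ne_eq, not_false_eq_true, true_and, false_or,
              or_false] at hab' h0'
            omega
        · have hs' : (p a).1 = !s := Bool.eq_not.mpr hs
          simp only [hs, false_and, or_false] at h0
          rcases Nat.lt_or_ge (p a).2 (m - 1) with h | h
          · left; exact h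
          · right; exact ⟨hs', by omega⟩

/-! ### Lower bound -/

theorem isPrime_span_X (U : Set V) :
    (Ideal.span (X '' U : Set (MvPolynomial V K))).IsPrime := by
  classical
  let φ : MvPolynomial V K →ₐ[K] MvPolynomial V K := aeval (fun v => if v ∈ U then 0 else X v)
  have hle : Ideal.span (X '' U : Set (MvPolynomial V K)) ≤ RingHom.ker φ := by
    rw [Ideal.span_le]
    rintro _ ⟨u, hu, rfl⟩
    simp [φ, RingHom.mem_ker, hu]
  have key : ∀ f, f - φ f ∈ Ideal.span (X '' U : Set (MvPolynomial V K)) := by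
    intro f
    rw [← Ideal.Quotient.eq]
    have : (Ideal.Quotient.mkₐ K (Ideal.span (X '' U : Set (MvPolynomial V K)))) =
        (Ideal.Quotient.mkₐ K (Ideal.span (X '' U : Set (MvPolynomial V K)))).comp φ := by
      ext v
      by_cases hv : v ∈ U
      · simp only [φ, AlgHom.comp_apply, aeval_X, hv, if_true, map_zero]
        exact Ideal.Quotient.eq_zero_iff_mem.mpr (Ideal.subset_span ⟨v, hv, rfl⟩)
      · simp [φ, hv]
    exact DFunLike.congr_fun this f
  have heq : Ideal.span (X '' U : Set (MvPolynomial V K)) = RingHom.ker φ := by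
    refine le_antisymm hle fun f hf => ?_
    have := key f
    rwa [RingHom.mem_ker.mp hf, sub_zero] at this
  rw [heq]
  exact RingHom.ker_isPrime φ

theorem ofList_map_X (l : List V) :
    Ideal.ofList (l.map (X : V → MvPolynomial V K)) = Ideal.span (X '' {v | v ∈ l}) := by
  unfold Ideal.ofList
  congr 1
  ext f
  simp

theorem weaklyRegular_X (l : List V) (hl : l.Nodup) :
    RingTheory.Sequence.IsWeaklyRegular (MvPolynomial V K) (l.map (X : V → MvPolynomial V K)) := by
  induction l using List.reverseRecOn with
  | nil => simp
  | append_singleton l x ih =>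
    rw [List.nodup_append] at hl
    rw [List.map_append, RingTheory.Sequence.isWeaklyRegular_append_iff]
    refine ⟨ih hl.1, ?_⟩
    simp only [List.map_cons, List.map_nil]
    rw [RingTheory.Sequence.isWeaklyRegular_singleton_iff]
    have hx : x ∉ {v | v ∈ l} := fun h => hl.2.2 x h x (by simp) rfl
    have hI : (Ideal.ofList (l.map (X : V → MvPolynomial V K)) •
        (⊤ : Submodule (MvPolynomial V K) (MvPolynomial V K))) =
        Ideal.span (X '' {v | v ∈ l}) := by
      rw [ofList_map_X, smul_eq_mul, Ideal.mul_top]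
    rw [isSMulRegular_iff_right_eq_zero_of_smul]
    intro f hf
    obtain ⟨f, rfl⟩ := Submodule.Quotient.mk_surjective _ f
    rw [← Submodule.Quotient.mk_smul, Submodule.Quotient.mk_eq_zero, hI, smul_eq_mul] at hf
    rw [Submodule.Quotient.mk_eq_zero, hI]
    exact (mul_X_mem_span _ _ hx f).mp hf

/-- Any localized module of `M` is isomorphic to the categorical one. -/
noncomputable def localizedEquiv {R : Type u} [CommRing R] (T : Submonoid R) (M : ModuleCat.{u} R)
    {N : Type u} [AddCommGroup N] [Module R N] [Module (Localization T) N]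
    [IsScalarTower R (Localization T) N] (f : M →ₗ[R] N) [IsLocalizedModule T f] :
    N ≃ₗ[Localization T] M.localizedModule T :=
  LinearEquiv.extendScalarsOfIsLocalization T (Localization T)
    (IsLocalizedModule.linearEquiv T f (M.localizedModuleMkLinearMap T))

theorem pd_ge_of_localization {R : Type u} [CommRing R] [IsNoetherianRing R] (P : Ideal R)
    [P.IsPrime] (I : Ideal R) (rs : List R)
    (hreg : RingTheory.Sequence.IsRegular (Localization.AtPrime P)
      (rs.map (algebraMap R (Localization.AtPrime P))))
    (hI : Submodule.localized' (Localization.AtPrime P) P.primeCompl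
      (Algebra.linearMap R (Localization.AtPrime P)) I =
      Ideal.ofList (rs.map (algebraMap R (Localization.AtPrime P))))
    (d : ℕ) (h : HasProjectiveDimensionLE (ModuleCat.of R (R ⧸ I)) d) : rs.length ≤ d := by
  have hnoeth : IsNoetherianRing (Localization.AtPrime P) :=
    IsLocalization.isNoetherianRing P.primeCompl _ inferInstance
  have hloc := ModuleCat.localizedModule_hasProjectiveDimensionLE d P.primeCompl
    (ModuleCat.of R (R ⧸ I))
  let e1 : (Localization.AtPrime P ⧸ Submodule.localized' (Localization.AtPrime P) P.primeCompl (Algebra.linearMap R (Localization.AtPrime P)) I) ≃ₗ[Localization.AtPrime P]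
      (ModuleCat.of R (R ⧸ I)).localizedModule P.primeCompl :=
    localizedEquiv P.primeCompl (ModuleCat.of R (R ⧸ I))
      (Submodule.toLocalizedQuotient' (Localization.AtPrime P) P.primeCompl
        (Algebra.linearMap R (Localization.AtPrime P)) I)
  let e2 : Shrink.{u} (Localization.AtPrime P ⧸ Ideal.ofList (rs.map (algebraMap R (Localization.AtPrime P)))) ≃ₗ[Localization.AtPrime P]
      (Localization.AtPrime P ⧸ Submodule.localized' (Localization.AtPrime P) P.primeCompl (Algebra.linearMap R (Localization.AtPrime P)) I) :=
    (Shrink.linearEquiv (Localization.AtPrime P) _).trans (Submodule.quotEquivOfEq _ _ hI.symm)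
  have hpd := ModuleCat.projectiveDimension_quotient_eq_length.{u} _ hreg
  have hiso := projectiveDimension_eq_of_iso (e2.trans e1).toModuleIso
  rw [← projectiveDimension_le_iff] at hloc
  have hfin := (hpd.symm.trans hiso).trans_le hloc
  rw [List.length_map] at hfin
  exact_mod_cast hfin

theorem pd_lower [Finite V] (G : SimpleGraph V) (U : Finset V)
    (hU : ∀ i j, G.Adj i j → i ∈ U ∨ j ∈ U) (hmin : ∀ u ∈ U, ∃ w, w ∉ U ∧ G.Adj u w)
    (d : ℕ) (h : HasProjectiveDimensionLE
      (ModuleCat.of (MvPolynomial V K) (MvPolynomial V K ⧸ edgeIdeal K G)) d) : U.card ≤ d := by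
  classical
  let R := MvPolynomial V K
  let P : Ideal R := Ideal.span (X '' (U : Set V))
  have hP : P.IsPrime := isPrime_span_X _
  let A := Localization.AtPrime P
  let I : Ideal R := edgeIdeal K G
  let rs : List R := U.toList.map X
  have hofl : Ideal.ofList rs = P := (ofList_map_X U.toList).trans (by
    simp only [P]
    congr 2
    ext; simp)
  have hreg : RingTheory.Sequence.IsRegular A (rs.map (algebraMap R A)) :=
    (weaklyRegular_X U.toList U.nodup_toList).isRegular_of_isLocalization_of_mem A P
      (fun r hr => by
        obtain ⟨v, hv, rfl⟩ := List.mem_map.mp hr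
        exact Ideal.subset_span ⟨v, by simpa using hv, rfl⟩)
  -- identify the localized ideal
  have hI : Submodule.localized' A P.primeCompl (Algebra.linearMap R A) I =
      Ideal.ofList (rs.map (algebraMap R A)) := by
    rw [← Ideal.map_ofList, hofl, Ideal.localized'_eq_map]
    apply le_antisymm
    · apply Ideal.map_mono
      simp only [I, edgeIdeal]
      rw [Ideal.span_le]
      rintro _ ⟨i, j, hij, rfl⟩
      rcases hU i j hij with h | h
      · exact Ideal.mul_mem_right _ _ (Ideal.subset_span ⟨i, h, rfl⟩)
      · exact Ideal.mul_mem_left _ _ (Ideal.subset_span ⟨j, h, rfl⟩)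
    · rw [Ideal.map_le_iff_le_comap]
      simp only [P]
      rw [Ideal.span_le]
      rintro _ ⟨u, hu, rfl⟩
      obtain ⟨w, hw, huw⟩ := hmin u hu
      have hXw : (X w : R) ∉ P := by
        intro hmem
        have := (mul_X_mem_span (K := K) (U : Set V) w (by simpa using hw) 1).mp (by simpa using hmem)
        exact hP.ne_top ((Ideal.eq_top_iff_one _).mpr this)
      have hunit : IsUnit (algebraMap R A (X w)) :=
        IsLocalization.map_units A (⟨X w, hXw⟩ : P.primeCompl)
      have hmem : algebraMap R A (X u * X w) ∈ Ideal.map (algebraMap R A) I :=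
        Ideal.mem_map_of_mem _ (Ideal.subset_span ⟨u, w, huw, rfl⟩)
      rw [map_mul] at hmem
      exact (Ideal.mul_unit_mem_iff_mem _ hunit).mp hmem
  have := pd_ge_of_localization P I rs hreg hI d h
  simpa [rs] using this

/-! ### The graph `B n` -/

/-- Coordinates of the vertices of `B n`. -/
def coordB (n : ℕ) : Fin n ⊕ Fin (n + 1) → Bool × ℕ
  | .inl i => (false, i)
  | .inr i => (true, i)

theorem coordB_injective (n : ℕ) : Function.Injective (coordB n) := by
  rintro (a | a) (b | b) h <;> simp_all [coordB, Fin.ext_iff]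

theorem graphB_adj (n : ℕ) (a b : Fin n ⊕ Fin (n + 1)) :
    (graphB n).Adj a b ↔
      ((coordB n a).1 = (coordB n b).1 ∧
        ((coordB n a).2 + 1 = (coordB n b).2 ∨ (coordB n b).2 + 1 = (coordB n a).2)) ∨
      ((coordB n a).1 ≠ (coordB n b).1 ∧ (coordB n a).2 = (coordB n b).2) := by
  rcases a with a | a <;> rcases b with b | b <;>
    simp [graphB, SimpleGraph.fromRel_adj, coordB, Fin.ext_iff] <;> omega

/-- A maximal independent set of `B n` (in coordinates) of the smallest possible size. -/
def indepB (n : ℕ) (q : Bool × ℕ) : Prop :=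
  q.2 < n ∧ (((n - 1 - q.2) % 4 = 0 ∧ q.1 = true) ∨ ((n - 1 - q.2) % 4 = 2 ∧ q.1 = false) ∨
    (q.2 = 0 ∧ n % 4 = 2 ∧ q.1 = false) ∨ (q.2 = 0 ∧ n % 4 = 0 ∧ q.1 = true))

theorem lower_graphB (n : ℕ) (hn : 2 ≤ n) (d : ℕ)
    (h : HasProjectiveDimensionLE (ModuleCat.of (MvPolynomial (Fin n ⊕ Fin (n + 1)) K)
      (MvPolynomial (Fin n ⊕ Fin (n + 1)) K ⧸ edgeIdeal K (graphB n))) d) :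
    2 * n - n / 2 ≤ d := by
  classical
  have hcover := pd_lower (graphB n) (Finset.univ.filter (fun v => ¬ indepB n (coordB n v)))
    (by
      intro a b hab
      rw [graphB_adj] at hab
      simp only [Finset.mem_filter, Finset.mem_univ, true_and]
      by_contra hcon
      push Not at hcon
      obtain ⟨⟨h1, h2⟩, h3, h4⟩ := hcon
      rcases hqa : coordB n a with ⟨s, i⟩
      rcases hqb : coordB n b with ⟨t, j⟩
      simp only [hqa, hqb] at *
      cases s <;> cases t <;> simp at * <;> omega)
    (by
      have hex : ∀ s, ∀ i < n, ∃ v, coordB n v = (s, i) := by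
        intro s i hi
        cases s
        · exact ⟨.inl ⟨i, hi⟩, rfl⟩
        · exact ⟨.inr ⟨i, by omega⟩, rfl⟩
      have hdom : ∀ t j, j < n + 1 → (t = false → j < n) → ¬ indepB n (t, j) →
          ∃ s i, indepB n (s, i) ∧ ((t = s ∧ (j + 1 = i ∨ i + 1 = j)) ∨ (t ≠ s ∧ j = i)) := by
        intro t j hj htj hind
        by_cases c1 : indepB n (!t, j)
        · exact ⟨!t, j, c1, Or.inr ⟨by simp, rfl⟩⟩
        · by_cases c2 : indepB n (t, j + 1)
          · exact ⟨t, j + 1, c2, Or.inl ⟨rfl, Or.inl rfl⟩⟩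
          · refine ⟨t, j - 1, ?_, ?_⟩
            · unfold indepB at *
              cases t <;> simp at * <;> omega
            · unfold indepB at *
              cases t <;> simp at * <;> omega
      intro u hu
      simp only [Finset.mem_filter, Finset.mem_univ, true_and] at hu
      obtain ⟨s, i, hsi, hadj⟩ := hdom (coordB n u).1 (coordB n u).2
        (by rcases u with u | u <;> simp [coordB] <;> omega)
        (by rcases u with u | u <;> simp [coordB]) hu
      obtain ⟨v, hv⟩ := hex s i hsi.1
      refine ⟨v, ?_, ?_⟩
      · simp [hv, hsi]
      · rw [graphB_adj, hv]
        exact hadj) d h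
  refine le_trans ?_ hcover
  have hcompl := Finset.card_filter_add_card_filter_not (s := Finset.univ)
    (fun v => indepB n (coordB n v))
  have hcardV : (Finset.univ : Finset (Fin n ⊕ Fin (n + 1))).card = 2 * n + 1 := by
    simp; omega
  have hW : (Finset.univ.filter (fun v => indepB n (coordB n v))).card ≤ n / 2 + 1 := by
    have : ((Finset.range (n / 2 + 1)).card) = n / 2 + 1 := Finset.card_range _
    rw [← this]
    refine Finset.card_le_card_of_injOn (fun v => ((coordB n v).2 + 1) / 2) ?_ ?_
    · intro v hv
      simp only [Finset.coe_filter, Finset.mem_univ, true_and, Set.mem_ofPred_eq] at hv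
      have := hv.1
      simp only [Finset.coe_range, Set.mem_Iio]
      omega
    · intro v hv w hw hvw
      simp only [Finset.coe_filter, Finset.mem_univ, true_and, Set.mem_ofPred_eq] at hv hw hvw
      apply coordB_injective n
      rcases hqa : coordB n v with ⟨s, i⟩
      rcases hqb : coordB n w with ⟨t, j⟩
      rw [hqa] at hv hvw
      rw [hqb] at hw hvw
      unfold indepB at hv hw
      cases s <;> cases t <;> simp at * <;> omega
  omega

theorem upper_graphB (n : ℕ) :
    HasProjectiveDimensionLE (ModuleCat.of (MvPolynomial (Fin n ⊕ Fin (n + 1)) K)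
      (MvPolynomial (Fin n ⊕ Fin (n + 1)) K ⧸ edgeIdeal K (graphB n))) (2 * n - n / 2) := by
  have := pd_ladder_upper (K := K) (graphB n) (coordB n) (coordB_injective n) (graphB_adj n) n
    (by
      intro s i hi
      cases s
      · exact ⟨.inl ⟨i, hi⟩, rfl⟩
      · exact ⟨.inr ⟨i, by omega⟩, rfl⟩) n le_rfl true ∅
    (by
      intro a _ _ _ _
      rcases a with a | a
      · left; exact a.2
      · have := a.2
        simp only [coordB, true_and]
        omega)
  have e : killIdeal K (graphB n) ((∅ : Finset (Fin n ⊕ Fin (n + 1))) : Set _) =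
      edgeIdeal K (graphB n) := by simp [killIdeal]
  rw [e] at this
  simpa [PdLT] using this

end PdimAux

theorem pdim_graphB (n : ℕ) (hn : 2 ≤ n) (K : Type*) [Field K] :
    pdimQuot (edgeIdeal K (graphB n)) = 2 * n - ⌈((n : ℚ) + 1) / 2⌉₊ + 1 := by
  have hceil : ⌈((n : ℚ) + 1) / 2⌉₊ = n / 2 + 1 := by
    rw [Nat.ceil_eq_iff (by omega)]
    have h1 : n = 2 * (n / 2) + n % 2 := by omega
    have h2 : n % 2 < 2 := Nat.mod_lt _ (by norm_num)
    generalize n / 2 = k at *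
    generalize n % 2 = r at *
    subst h1
    have h3 : (r : ℚ) ≤ 1 := by exact_mod_cast (by omega : r ≤ 1)
    have h4 : (0 : ℚ) ≤ r := by positivity
    push_cast
    constructor <;> linarith
  rw [hceil, pdimQuot]
  have hval : 2 * n - (n / 2 + 1) + 1 = 2 * n - n / 2 := by omega
  rw [hval]
  have hmem : 2 * n - n / 2 ∈ {d : ℕ | pdimLE (MvPolynomial (Fin n ⊕ Fin (n + 1)) K) d
      (MvPolynomial (Fin n ⊕ Fin (n + 1)) K ⧸ edgeIdeal K (graphB n))} :=
    (PdimAux.pdimLE_iff _ _).mpr (PdimAux.upper_graphB n)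
  apply le_antisymm
  · exact Nat.sInf_le hmem
  · exact le_csInf ⟨_, hmem⟩ fun d hd =>
      PdimAux.lower_graphB n hn d ((PdimAux.pdimLE_iff _ _).mp hd)
end

section
/- Let n ≥ 2, let K be a field, let A_n be the ladder graph on 2n vertices, and let S = K[V(A_n)]. Then depth(S/I(A_n)) = 2n − ⌊3n/2⌋ = ⌈n/2⌉. -/
open MvPolynomial

namespace LadderDepth

open RingTheory.Sequence

/-- Elementary regular sequences modulo an ideal. -/
def Reg {S : Type*} [CommRing S] : Ideal S → List S → Prop
  | _, [] => True
  | J, r :: rs => (∀ f, r * f ∈ J → f ∈ J) ∧ Reg (J ⊔ Ideal.span {r}) rs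

theorem Reg.ext {S : Type*} [CommRing S] (v : S) (rs : List S) :
    ∀ (J C : Ideal S), (∀ f, f ∈ C ↔ v * f ∈ J) → Reg C rs → Reg (J ⊔ Ideal.span {v}) rs →
      Reg J rs := by
  induction rs with
  | nil => intro J C _ _ _; trivial
  | cons r rs ih =>
    intro J C hC h1 h2
    obtain ⟨h1a, h1b⟩ := h1
    obtain ⟨h2a, h2b⟩ := h2
    refine ⟨?_, ?_⟩
    · intro f hf
      have h3 : f ∈ J ⊔ Ideal.span {v} := h2a f (Ideal.mem_sup_left hf)
      obtain ⟨j, hj, w, hw, rfl⟩ := Submodule.mem_sup.1 h3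
      obtain ⟨h, rfl⟩ := Ideal.mem_span_singleton'.1 hw
      refine J.add_mem hj ?_
      rw [mul_comm]
      refine (hC h).1 (h1a h ((hC _).2 ?_))
      have := J.sub_mem hf (J.mul_mem_left r hj)
      convert this using 1
      ring
    · refine ih (J ⊔ Ideal.span {r}) (C ⊔ Ideal.span {r}) ?_ h1b ?_
      · intro f
        constructor
        · intro hf
          obtain ⟨c, hc, w, hw, rfl⟩ := Submodule.mem_sup.1 hf
          rw [mul_add]
          exact Ideal.add_mem _ (Ideal.mem_sup_left ((hC c).1 hc))
            (Ideal.mem_sup_right (Ideal.mul_mem_left _ _ hw))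
        · intro hf
          obtain ⟨j, hj, w, hw, hjw⟩ := Submodule.mem_sup.1 hf
          obtain ⟨g, rfl⟩ := Ideal.mem_span_singleton'.1 hw
          have h3 : g ∈ J ⊔ Ideal.span {v} := by
            apply h2a
            have : r * g = v * f - j := by rw [← hjw]; ring
            rw [this]
            exact Ideal.sub_mem _ (Ideal.mem_sup_right
              (Ideal.mul_mem_right _ _ (Ideal.mem_span_singleton_self v))) (Ideal.mem_sup_left hj)
          obtain ⟨j', hj', w', hw', rfl⟩ := Submodule.mem_sup.1 h3
          obtain ⟨h, rfl⟩ := Ideal.mem_span_singleton'.1 hw'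
          have h4 : f - r * h ∈ C := by
            rw [hC]
            have : v * (f - r * h) = j + r * j' := by
              rw [mul_sub, ← hjw]; ring
            rw [this]
            exact J.add_mem hj (J.mul_mem_left _ hj')
          have : f = (f - r * h) + r * h := by ring
          rw [this]
          exact Ideal.add_mem _ (Ideal.mem_sup_left h4) (Ideal.mem_sup_right
              (Ideal.mul_mem_right _ _ (Ideal.mem_span_singleton_self r)))
      · rw [sup_right_comm]; exact h2b

theorem mem_map_equiv {S : Type*} [CommRing S] (e : S ≃+* S) (J : Ideal S) (g : S) :
    g ∈ J.map (e : S →+* S) ↔ e.symm g ∈ J := by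
  rw [Ideal.mem_map_iff_of_surjective (e : S →+* S) e.surjective]
  constructor
  · rintro ⟨x, hx, rfl⟩
    simpa using hx
  · intro h
    exact ⟨_, h, by simp⟩

theorem Reg.map {S : Type*} [CommRing S] (e : S ≃+* S) (rs : List S) :
    ∀ (J : Ideal S), Reg J rs → Reg (J.map (e : S →+* S)) (rs.map e) := by
  induction rs with
  | nil => intro J _; trivial
  | cons r rs ih =>
    intro J h
    obtain ⟨ha, hb⟩ := h
    refine ⟨?_, ?_⟩
    · intro f hf
      rw [mem_map_equiv] at hf ⊢
      apply ha
      simpa using hf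
    · have := ih _ hb
      rwa [Ideal.map_sup, Ideal.map_span, Set.image_singleton] at this

/-- Iterated quotient. -/
noncomputable def quotEquiv {S : Type*} [CommRing S] (J : Ideal S) (r : S) :
    QuotSMulTop r (S ⧸ J) ≃ₗ[S] S ⧸ (J ⊔ Ideal.span {r}) :=
  (Submodule.quotEquivOfEq _ _ (by
    ext x
    rw [Submodule.mem_smul_pointwise_iff_exists, Submodule.mem_map]
    constructor
    · rintro ⟨y, -, rfl⟩
      obtain ⟨y, rfl⟩ := Submodule.mkQ_surjective _ y
      exact ⟨r * y, Ideal.mem_sup_right (Ideal.mul_mem_right _ _ (Ideal.mem_span_singleton_self r)),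
        by simp [← smul_eq_mul]⟩
    · rintro ⟨y, hy, rfl⟩
      obtain ⟨j, hj, w, hw, rfl⟩ := Submodule.mem_sup.1 hy
      obtain ⟨g, rfl⟩ := Ideal.mem_span_singleton'.1 hw
      refine ⟨Submodule.mkQ _ g, trivial, ?_⟩
      rw [map_add, ← map_smul, smul_eq_mul, mul_comm r g]
      have : Submodule.mkQ J j = 0 := Ideal.Quotient.eq_zero_iff_mem.2 hj
      rw [this, zero_add])).trans
  (Submodule.quotientQuotientEquivQuotient J (J ⊔ Ideal.span {r}) le_sup_left)

theorem isSMulRegular_iff {S : Type*} [CommRing S] (J : Ideal S) (r : S) :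
    IsSMulRegular (S ⧸ J) r ↔ ∀ f, r * f ∈ J → f ∈ J := by
  rw [isSMulRegular_iff_right_eq_zero_of_smul]
  constructor
  · intro h f hf
    have := h (Ideal.Quotient.mk J f) (by
      rw [← Ideal.Quotient.mk_eq_mk, ← Submodule.Quotient.mk_smul]
      rw [Submodule.Quotient.mk_eq_zero]; exact hf)
    exact Ideal.Quotient.eq_zero_iff_mem.1 this
  · intro h x hx
    obtain ⟨f, rfl⟩ := Ideal.Quotient.mk_surjective x
    rw [← Ideal.Quotient.mk_eq_mk, ← Submodule.Quotient.mk_smul,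
      Submodule.Quotient.mk_eq_zero] at hx
    exact Ideal.Quotient.eq_zero_iff_mem.2 (h f hx)

theorem Reg.isRegular {S : Type*} [CommRing S] (rs : List S) :
    ∀ (J : Ideal S), Reg J rs → J ⊔ Ideal.ofList rs ≠ ⊤ → IsRegular (S ⧸ J) rs := by
  induction rs with
  | nil =>
    intro J _ h
    have : Nontrivial (S ⧸ J) := Ideal.Quotient.nontrivial_iff.2 (by simpa using h)
    exact IsRegular.nil _ _
  | cons r rs ih =>
    intro J h h'
    rw [isRegular_cons_iff, isSMulRegular_iff]
    refine ⟨h.1, ?_⟩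
    rw [(quotEquiv J r).isRegular_congr]
    refine ih _ h.2 ?_
    rwa [Ideal.ofList_cons, ← sup_assoc] at h'

open CategoryTheory Abelian in
theorem Reg.ext_quot {S : Type*} [CommRing S] (N : ModuleCat S) (rs : List S) :
    ∀ (J : Ideal S) (d : ℕ), Reg J rs →
      (∀ i < d + rs.length, Subsingleton (Ext N (ModuleCat.of S (S ⧸ J)) i)) →
      ∀ i < d, Subsingleton (Ext N (ModuleCat.of S (S ⧸ (J ⊔ Ideal.ofList rs))) i) := by
  induction rs with
  | nil =>
    intro J d _ h i hi
    rw [Ideal.ofList_nil, sup_bot_eq]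
    exact h i (by simpa using hi)
  | cons r rs ih =>
    intro J d hreg h i hi
    rw [Ideal.ofList_cons, ← sup_assoc]
    refine ih _ d hreg.2 ?_ i hi
    intro i hi
    have hx : IsSMulRegular (S ⧸ J) r := (isSMulRegular_iff J r).2 hreg.1
    have hx' : IsSMulRegular (ModuleCat.of S (S ⧸ J)) r := hx
    have key : Subsingleton
        (Ext N (ModuleCat.of S (QuotSMulTop r (ModuleCat.of S (S ⧸ J)))) i) := by
      have zero1 := AddCommGrpCat.isZero_of_iff_subsingleton.mpr
        (h i (by simp only [List.length_cons]; omega))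
      have zero2 := AddCommGrpCat.isZero_of_iff_subsingleton.mpr
        (h (i + 1) (by simp only [List.length_cons]; omega))
      exact AddCommGrpCat.subsingleton_of_isZero <| ShortComplex.Exact.isZero_of_both_zeros
        ((Ext.covariant_sequence_exact₃' N hx'.smulShortComplex_shortExact) i (i + 1) rfl)
        (zero1.eq_zero_of_src _) (zero2.eq_zero_of_tgt _)
    have e : ModuleCat.of S (QuotSMulTop r (ModuleCat.of S (S ⧸ J))) ≅
      ModuleCat.of S (S ⧸ (J ⊔ Ideal.span {r})) := (quotEquiv J r).toModuleIso
    have e2 : Ext N (ModuleCat.of S (QuotSMulTop r (ModuleCat.of S (S ⧸ J)))) i ≃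
        Ext N (ModuleCat.of S (S ⧸ (J ⊔ Ideal.span {r}))) i :=
      ((extFunctorObj N i).mapIso e).addCommGroupIsoToAddEquiv.toEquiv
    exact e2.symm.subsingleton

section Graph

variable (K : Type*) [Field K] {V : Type*} (G : SimpleGraph V)

/-- Exponents generating the restricted edge ideal. -/
def expo (W : Set V) : Set (V →₀ ℕ) :=
  {m | (∃ i j, G.Adj i j ∧ m = Finsupp.single i 1 + Finsupp.single j 1) ∨
    ∃ u, u ∉ W ∧ m = Finsupp.single u 1}

/-- Edge ideal plus the variables outside of `W`. -/
noncomputable def JJ (W : Set V) : Ideal (MvPolynomial V K) :=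
  Ideal.span ((fun m => monomial m (1 : K)) '' expo G W)

/-- The support of `m` is not an independent subset of `W`. -/
def Bad (W : Set V) (m : V →₀ ℕ) : Prop :=
  (∃ i j, G.Adj i j ∧ m i ≠ 0 ∧ m j ≠ 0) ∨ ∃ u, u ∉ W ∧ m u ≠ 0

theorem mem_JJ (W : Set V) (f : MvPolynomial V K) :
    f ∈ JJ K G W ↔ ∀ m ∈ f.support, Bad G W m := by
  classical
  unfold JJ
  rw [mem_ideal_span_monomial_image]
  refine forall₂_congr fun m _ => ?_
  constructor
  · rintro ⟨s, hs, hle⟩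
    rcases hs with ⟨i, j, hij, rfl⟩ | ⟨u, hu, rfl⟩
    · left
      refine ⟨i, j, hij, ?_, ?_⟩
      · have := hle i
        simp at this; omega
      · have := hle j
        simp at this; omega
    · right
      refine ⟨u, hu, ?_⟩
      have := hle u
      simp at this; omega
  · rintro (⟨i, j, hij, hi, hj⟩ | ⟨u, hu, hmu⟩)
    · refine ⟨_, Or.inl ⟨i, j, hij, rfl⟩, ?_⟩
      intro k
      have hne := hij.ne
      simp only [Finsupp.add_apply, Finsupp.single_apply]
      split_ifs with h1 h2 h2
      · exact absurd (h1.trans h2.symm) hne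
      · subst h1; omega
      · subst h2; omega
      · omega
    · refine ⟨_, Or.inr ⟨u, hu, rfl⟩, ?_⟩
      intro k
      simp only [Finsupp.single_apply]
      split_ifs with h1
      · subst h1; omega
      · omega

theorem colon_JJ (W : Set V) (v : V) (hv : v ∈ W) (f : MvPolynomial V K) :
    f ∈ JJ K G (W \ {u | G.Adj v u}) ↔ X v * f ∈ JJ K G W := by
  classical
  rw [mem_JJ, mem_JJ, support_X_mul]
  simp only [Finset.mem_map, addLeftEmbedding_apply, forall_exists_index, and_imp,
    forall_apply_eq_imp_iff₂]
  refine forall₂_congr fun m _ => ?_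
  have hs : ∀ k, (Finsupp.single v 1 + m : V →₀ ℕ) k ≠ 0 ↔ k = v ∨ m k ≠ 0 := by
    intro k
    simp only [Finsupp.add_apply, Finsupp.single_apply]
    split_ifs with h
    · simp [h]
    · simp [Ne.symm h]
  unfold Bad
  simp only [hs]
  constructor
  · rintro (⟨i, j, hij, hi, hj⟩ | ⟨u, hu, hmu⟩)
    · exact Or.inl ⟨i, j, hij, Or.inr hi, Or.inr hj⟩
    · by_cases h : u ∈ W
      · have : G.Adj v u := by
          by_contra h'
          exact hu ⟨h, h'⟩
        exact Or.inl ⟨v, u, this, Or.inl rfl, Or.inr hmu⟩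
      · exact Or.inr ⟨u, h, Or.inr hmu⟩
  · rintro (⟨i, j, hij, hi, hj⟩ | ⟨u, hu, hmu⟩)
    · rcases hi with rfl | hi
      · rcases hj with rfl | hj
        · exact absurd hij (G.irrefl)
        · exact Or.inr ⟨j, fun h => h.2 hij, hj⟩
      · rcases hj with rfl | hj
        · exact Or.inr ⟨i, fun h => h.2 hij.symm, hi⟩
        · exact Or.inl ⟨i, j, hij, hi, hj⟩
    · rcases hmu with rfl | hmu
      · exact absurd hv hu
      · exact Or.inr ⟨u, fun h => hu h.1, hmu⟩

theorem sup_JJ (W : Set V) (v : V) :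
    JJ K G W ⊔ Ideal.span {X v} = JJ K G (W \ {v}) := by
  have : ({X v} : Set (MvPolynomial V K)) =
      (fun m => monomial m (1 : K)) '' {Finsupp.single v 1} := by
    rw [Set.image_singleton]; rfl
  rw [this, JJ, JJ, ← Ideal.span_union, ← Set.image_union]
  congr 2
  ext m
  simp only [expo, Set.mem_union, Set.mem_ofPred_eq, Set.mem_singleton_iff, Set.mem_sdiff]
  constructor
  · rintro ((h | ⟨u, hu, rfl⟩) | rfl)
    · exact Or.inl h
    · exact Or.inr ⟨u, by tauto, rfl⟩
    · exact Or.inr ⟨v, by tauto, rfl⟩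
  · rintro (h | ⟨u, hu, rfl⟩)
    · exact Or.inl (Or.inl h)
    · by_cases h : u = v
      · subst h; exact Or.inr rfl
      · exact Or.inl (Or.inr ⟨u, by tauto, rfl⟩)

theorem JJ_univ : JJ K G Set.univ = edgeIdeal K G := by
  unfold JJ edgeIdeal
  congr 1
  ext m
  simp only [expo, Set.mem_image, Set.mem_ofPred_eq]
  constructor
  · rintro ⟨s, (⟨i, j, h, rfl⟩ | ⟨u, hu, rfl⟩), rfl⟩
    · refine ⟨i, j, h, ?_⟩
      simp [X, monomial_mul]
    · exact absurd trivial hu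
  · rintro ⟨i, j, h, rfl⟩
    refine ⟨_, Or.inl ⟨i, j, h, rfl⟩, ?_⟩
    simp [X, monomial_mul]

theorem branch (W : Set V) (v : V) (hv : v ∈ W) (rs : List (MvPolynomial V K))
    (h1 : Reg (JJ K G (W \ {u | G.Adj v u})) rs) (h2 : Reg (JJ K G (W \ {v})) rs) :
    Reg (JJ K G W) rs :=
  Reg.ext (X v) rs _ _ (colon_JJ K G W v hv) h1 (by rwa [sup_JJ])

/-- `v` is an isolated vertex of the graph induced on `W`. -/
def Isol (W : Set V) (v : V) : Prop := v ∈ W ∧ ∀ u ∈ W, ¬ G.Adj v u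

theorem reg_isol (vs : List V) : ∀ W : Set V, vs.Nodup → (∀ v ∈ vs, Isol G W v) →
    Reg (JJ K G W) (vs.map X) := by
  induction vs with
  | nil => intro W _ _; trivial
  | cons v vs ih =>
    intro W hn hi
    rw [List.nodup_cons] at hn
    refine ⟨?_, ?_⟩
    · intro f hf
      obtain ⟨hv, hv2⟩ := hi v (by simp)
      rw [← colon_JJ K G W v hv] at hf
      convert hf using 2
      ext u
      simp only [Set.mem_sdiff, Set.mem_ofPred_eq]
      exact ⟨fun h => ⟨h, hv2 u h⟩, fun h => h.1⟩
    · rw [sup_JJ]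
      refine ih _ hn.2 ?_
      intro u hu
      obtain ⟨h1, h2⟩ := hi u (by simp [hu])
      exact ⟨⟨h1, fun h => hn.1 (by rw [← h]; exact hu)⟩, fun w hw => h2 w hw.1⟩

variable [Fintype V] [DecidableEq V]

set_option linter.unusedSectionVars false

/-- Sum of the variables in a block. -/
noncomputable def lin (blk : V → ℕ) (j : ℕ) : MvPolynomial V K :=
  ∑ v with blk v = j, X v

theorem reg_base (blk : V → ℕ) (m : ℕ) (W : Set V)
    (h : ∀ j < m, ∃ v, blk v = j ∧ Isol G W v) :
    Reg (JJ K G W) ((List.range m).map (lin K blk)) := by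
  classical
  obtain ⟨w, hw⟩ : ∃ w : ℕ → Option V, ∀ j < m, ∃ v, w j = some v ∧ blk v = j ∧ Isol G W v := by
    refine ⟨fun j => if hj : j < m then some (h j hj).choose else none, fun j hj => ?_⟩
    exact ⟨(h j hj).choose, by simp [hj], (h j hj).choose_spec⟩
  -- `u` is a chosen vertex
  let ch : V → Prop := fun u => blk u < m ∧ w (blk u) = some u
  have hch : ∀ u, ch u → Isol G W u := by
    rintro u ⟨h1, h2⟩
    obtain ⟨v, hv, -, hv'⟩ := hw _ h1
    rw [h2] at hv
    rw [Option.some.inj hv]; exact hv'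
  have huniq : ∀ u v, ch u → ch v → blk u = blk v → u = v := by
    rintro u v ⟨h1, h2⟩ ⟨h3, h4⟩ h5
    rw [h5, h4] at h2
    exact (Option.some.inj h2).symm
  let rest : V → MvPolynomial V K := fun u => ∑ v with (blk v = blk u ∧ v ≠ u), X v
  have hlin : ∀ u, lin K blk (blk u) = X u + rest u := by
    intro u
    have : (Finset.univ.filter fun v => blk v = blk u) =
        insert u (Finset.univ.filter fun v => blk v = blk u ∧ v ≠ u) := by
      ext v; by_cases hvu : v = u <;> simp [hvu]
    unfold lin
    rw [this, Finset.sum_insert (by simp)]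
  let φ : MvPolynomial V K →ₐ[K] MvPolynomial V K :=
    aeval fun u => if ch u then X u + rest u else X u
  let ψ : MvPolynomial V K →ₐ[K] MvPolynomial V K :=
    aeval fun u => if ch u then X u - rest u else X u
  have φX : ∀ u, φ (X u) = if ch u then X u + rest u else X u := fun u => by simp [φ]
  have ψX : ∀ u, ψ (X u) = if ch u then X u - rest u else X u := fun u => by simp [ψ]
  have φrest : ∀ u, ch u → φ (rest u) = rest u := by
    intro u hu
    simp only [rest, map_sum]
    refine Finset.sum_congr rfl fun v hv => ?_
    rw [Finset.mem_filter] at hv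
    rw [φX, if_neg]
    intro hc
    exact hv.2.2 (huniq v u hc hu hv.2.1)
  have ψrest : ∀ u, ch u → ψ (rest u) = rest u := by
    intro u hu
    simp only [rest, map_sum]
    refine Finset.sum_congr rfl fun v hv => ?_
    rw [Finset.mem_filter] at hv
    rw [ψX, if_neg]
    intro hc
    exact hv.2.2 (huniq v u hc hu hv.2.1)
  let e : MvPolynomial V K ≃ₐ[K] MvPolynomial V K := AlgEquiv.ofAlgHom φ ψ
    (by
      ext1 u
      simp only [AlgHom.comp_apply, AlgHom.id_apply, ψX]
      split_ifs with hu
      · rw [map_sub, φrest u hu, φX, if_pos hu]; ring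
      · rw [φX, if_neg hu])
    (by
      ext1 u
      simp only [AlgHom.comp_apply, AlgHom.id_apply, φX]
      split_ifs with hu
      · rw [map_add, ψrest u hu, ψX, if_pos hu]; ring
      · rw [ψX, if_neg hu])
  have gen_edge : ∀ i j, G.Adj i j → (X i * X j : MvPolynomial V K) ∈ JJ K G W := by
    intro i j hij
    refine Ideal.subset_span ⟨_, Or.inl ⟨i, j, hij, rfl⟩, ?_⟩
    simp [X, monomial_mul]
  have gen_var : ∀ u, u ∉ W → (X u : MvPolynomial V K) ∈ JJ K G W := by
    intro u hu
    exact Ideal.subset_span ⟨_, Or.inr ⟨u, hu, rfl⟩, rfl⟩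
  have gen : ∀ (θ : MvPolynomial V K →ₐ[K] MvPolynomial V K), (∀ u, ¬ ch u → θ (X u) = X u) →
      ∀ f ∈ JJ K G W, θ f ∈ JJ K G W := by
    intro θ hθ
    suffices h : JJ K G W ≤ (JJ K G W).comap θ from h
    rw [JJ, Ideal.span_le]
    rintro _ ⟨s, (⟨i, j, hij, rfl⟩ | ⟨u, hu, rfl⟩), rfl⟩
    · have : (monomial (Finsupp.single i 1 + Finsupp.single j 1) (1 : K)) = X i * X j := by
        simp [X, monomial_mul]
      simp only [this, SetLike.mem_coe, Ideal.mem_comap, map_mul]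
      change _ ∈ JJ K G W
      by_cases hi : ch i
      · have hj : j ∉ W := fun hj => (hch i hi).2 j hj hij
        rw [hθ j fun hc => hj (hch j hc).1]
        exact Ideal.mul_mem_left _ _ (gen_var j hj)
      · by_cases hj : ch j
        · have hi' : i ∉ W := fun hi' => (hch j hj).2 i hi' hij.symm
          rw [hθ i hi]
          exact Ideal.mul_mem_right _ _ (gen_var i hi')
        · rw [hθ i hi, hθ j hj]
          exact gen_edge i j hij
    · change θ (X u) ∈ JJ K G W
      rw [hθ u fun hc => hu (hch u hc).1]
      exact gen_var u hu
  have hmap : (JJ K G W).map ((e : MvPolynomial V K ≃+* MvPolynomial V K) :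
      MvPolynomial V K →+* MvPolynomial V K) = JJ K G W := by
    apply le_antisymm
    · rw [Ideal.map_le_iff_le_comap]
      intro f hf
      exact gen φ (fun u hu => by rw [φX, if_neg hu]) f hf
    · intro f hf
      rw [mem_map_equiv]
      exact gen ψ (fun u hu => by rw [ψX, if_neg hu]) f hf
  have hvs : ∃ vs : List V, vs.Nodup ∧ (∀ v ∈ vs, Isol G W v) ∧
      (vs.map X).map e = (List.range m).map (lin K blk) := by
    have hg : ∃ g : Fin m → V, ∀ j : Fin m, ch (g j) ∧ blk (g j) = j := by
      choose g hg using hw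
      refine ⟨fun j => g j j.2, fun j => ?_⟩
      obtain ⟨h1, h2, h3⟩ := hg j j.2
      exact ⟨⟨by rw [h2]; exact j.2, by rw [h2]; exact h1⟩, h2⟩
    obtain ⟨g, hg⟩ := hg
    refine ⟨(List.finRange m).map g, ?_, ?_, ?_⟩
    · refine List.Nodup.map ?_ (List.nodup_finRange m)
      intro a b hab
      apply Fin.ext
      rw [← (hg a).2, ← (hg b).2, hab]
    · intro v hv
      obtain ⟨j, -, rfl⟩ := List.mem_map.1 hv
      exact hch _ (hg j).1
    · rw [← List.map_coe_finRange_eq_range, List.map_map, List.map_map, List.map_map]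
      refine List.map_congr_left fun j _ => ?_
      simp only [Function.comp]
      have : e (X (g j)) = φ (X (g j)) := rfl
      rw [this, φX, if_pos (hg j).1, ← hlin, (hg j).2]
  obtain ⟨vs, h1, h2, h3⟩ := hvs
  have := Reg.map (e : MvPolynomial V K ≃+* MvPolynomial V K) _ _ (reg_isol K G vs W h1 h2)
  rw [hmap] at this
  rw [← h3]
  exact this

theorem Isol.diff_nbr {G : SimpleGraph V} {W : Set V} {v u : V} (h : Isol G W v) (hu : u ∈ W) :
    Isol G (W \ {w | G.Adj u w}) v :=
  ⟨⟨h.1, fun h' => h.2 u hu h'.symm⟩, fun w hw => h.2 w hw.1⟩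

theorem Isol.diff_single {G : SimpleGraph V} {W : Set V} {v u : V} (h : Isol G W v) (hu : v ≠ u) :
    Isol G (W \ {u}) v :=
  ⟨⟨h.1, hu⟩, fun w hw => h.2 w hw.1⟩

theorem isol_nbr (W : Set V) (u : V) (hu : u ∈ W) : Isol G (W \ {w | G.Adj u w}) u :=
  ⟨⟨hu, fun h => G.irrefl h⟩, fun _ hw h => hw.2 h⟩

/-- The induction state. -/
def St (col : V → ℕ) (side : V → Bool) (W : Set V) (j : ℕ) (b : Bool) : Prop :=
  (∀ i < j, ∃ v, col v / 2 = i ∧ Isol G W v) ∧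
  (∀ v, col v = 2 * j → side v = b → v ∈ W) ∧
  (∀ v, col v + 1 = 2 * j → side v = b → v ∉ W) ∧
  (∀ v, 2 * j < col v → v ∈ W)

theorem reg_main (col : V → ℕ) (side : V → Bool) (n : ℕ)
    (hadj : ∀ u v, G.Adj u v ↔ (side u = side v ∧ (col u + 1 = col v ∨ col v + 1 = col u)) ∨
      (side u ≠ side v ∧ col u = col v))
    (hinj : ∀ u v, col u = col v → side u = side v → u = v)
    (hsurj : ∀ c < n, ∀ b, ∃ v, col v = c ∧ side v = b)
    (hcol : ∀ v, col v < n) (k : ℕ) :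
    ∀ (W : Set V) (j : ℕ) (b : Bool), n ≤ 2 * j + k → St G col side W j b →
      Reg (JJ K G W) ((List.range ((n + 1) / 2)).map (lin K fun v => col v / 2)) := by
  induction k using Nat.strong_induction_on with
  | _ k ih =>
  intro W j b hk hst
  by_cases hj : n ≤ 2 * j
  · refine reg_base K G _ _ W fun i hi => hst.1 i (by omega)
  push Not at hj
  have next : ∀ (W : Set V) (b : Bool), St G col side W (j + 1) b →
      Reg (JJ K G W) ((List.range ((n + 1) / 2)).map (lin K fun v => col v / 2)) := by
    intro W b h
    exact ih (k - 1) (by omega) W (j + 1) b (by omega) h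
  obtain ⟨p, hpc, hps⟩ := hsurj (2 * j) hj b
  obtain ⟨q, hqc, hqs⟩ := hsurj (2 * j) hj (!b)
  -- the case where `q` is missing
  have stepB : ∀ W : Set V, St G col side W j b → q ∉ W →
      Reg (JJ K G W) ((List.range ((n + 1) / 2)).map (lin K fun v => col v / 2)) := by
    rintro W ⟨s1, s2, s3, s4⟩ hq
    have hpW : p ∈ W := s2 p hpc hps
    by_cases hr : 2 * j + 1 < n
    · obtain ⟨r, hrc, hrs⟩ := hsurj (2 * j + 1) hr b
      have hrW : r ∈ W := s4 r (by omega)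
      refine branch K G W r hrW _ (next _ (!b) ⟨?_, ?_, ?_, ?_⟩) (next _ b ⟨?_, ?_, ?_, ?_⟩)
      · intro i hi
        by_cases hij : i < j
        · obtain ⟨v, hv, hv'⟩ := s1 i hij
          exact ⟨v, hv, hv'.diff_nbr hrW⟩
        · exact ⟨r, by omega, isol_nbr G W r hrW⟩
      · intro v h1 h2
        refine ⟨s4 v (by omega), ?_⟩
        simp only [Set.mem_ofPred_eq, hadj, hrs, h2, hrc, h1]
        cases b <;> simp <;> omega
      · intro v h1 h2 h3
        apply h3.2
        simp only [Set.mem_ofPred_eq, hadj, hrs, h2, hrc]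
        cases b <;> simp <;> omega
      · intro v h1
        refine ⟨s4 v (by omega), ?_⟩
        simp only [Set.mem_ofPred_eq, hadj, hrs, hrc]
        omega
      · intro i hi
        by_cases hij : i < j
        · obtain ⟨v, hv, hv'⟩ := s1 i hij
          exact ⟨v, hv, hv'.diff_single (by rintro rfl; omega)⟩
        · refine ⟨p, by omega, ⟨hpW, by rintro rfl; omega⟩, ?_⟩
          intro u hu h
          rw [hadj] at h
          rcases h with ⟨h1, h2 | h2⟩ | ⟨h1, h2⟩
          · exact hu.2 (hinj u r (by omega) (by rw [← h1, hps, hrs]))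
          · exact s3 u (by omega) (by rw [← h1, hps]) hu.1
          · apply hq
            rw [hinj q u (by omega) ?_]
            · exact hu.1
            · rw [hqs]
              rw [hps] at h1
              revert h1
              cases b <;> cases side u <;> simp
      · intro v h1 h2
        exact ⟨s4 v (by omega), by rintro rfl; omega⟩
      · intro v h1 h2 h3
        exact h3.2 (hinj v r (by omega) (by rw [h2, hrs]))
      · intro v h1
        exact ⟨s4 v (by omega), by rintro rfl; omega⟩
    · refine next W b ⟨?_, ?_, ?_, ?_⟩
      · intro i hi
        by_cases hij : i < j
        · exact s1 i hij
        · refine ⟨p, by omega, hpW, ?_⟩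
          intro u hu h
          rw [hadj] at h
          have := hcol u
          rcases h with ⟨h1, h2 | h2⟩ | ⟨h1, h2⟩
          · omega
          · exact s3 u (by omega) (by rw [← h1, hps]) hu
          · apply hq
            rw [hinj q u (by omega) ?_]
            · exact hu
            · rw [hqs]
              rw [hps] at h1
              revert h1
              cases b <;> cases side u <;> simp
      · intro v h1 h2
        have := hcol v
        omega
      · intro v h1 h2
        have := hcol v
        omega
      · intro v h1
        have := hcol v
        omega
  by_cases hq : q ∈ W
  · obtain ⟨s1, s2, s3, s4⟩ := hst
    refine branch K G W q hq _ (next _ (!b) ⟨?_, ?_, ?_, ?_⟩) (stepB _ ⟨?_, ?_, ?_, ?_⟩ ?_)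
    · intro i hi
      by_cases hij : i < j
      · obtain ⟨v, hv, hv'⟩ := s1 i hij
        exact ⟨v, hv, hv'.diff_nbr hq⟩
      · exact ⟨q, by omega, isol_nbr G W q hq⟩
    · intro v h1 h2
      refine ⟨s4 v (by omega), ?_⟩
      simp only [Set.mem_ofPred_eq, hadj, hqc]
      omega
    · intro v h1 h2 h3
      apply h3.2
      simp only [Set.mem_ofPred_eq, hadj, hqs, h2, hqc]
      simp; omega
    · intro v h1
      refine ⟨s4 v (by omega), ?_⟩
      simp only [Set.mem_ofPred_eq, hadj, hqc]
      omega
    · intro i hi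
      obtain ⟨v, hv, hv'⟩ := s1 i hi
      exact ⟨v, hv, hv'.diff_single (by rintro rfl; omega)⟩
    · intro v h1 h2
      refine ⟨s2 v h1 h2, ?_⟩
      rintro rfl
      rw [h2] at hqs
      revert hqs
      cases b <;> simp
    · intro v h1 h2 h3
      exact s3 v h1 h2 h3.1
    · intro v h1
      exact ⟨s4 v h1, by rintro rfl; omega⟩
    · intro h; exact h.2 rfl
  · exact stepB W hst hq

end Graph

section Concrete

/-- Column of a vertex. -/
def col {n : ℕ} : Fin n ⊕ Fin n → ℕ
  | .inl i => i
  | .inr i => i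

/-- Side of a vertex. -/
def side {n : ℕ} : Fin n ⊕ Fin n → Bool
  | .inl _ => true
  | .inr _ => false

theorem graphA_adj {n : ℕ} (u v : Fin n ⊕ Fin n) : (graphA n).Adj u v ↔
    (side u = side v ∧ (col u + 1 = col v ∨ col v + 1 = col u)) ∨
      (side u ≠ side v ∧ col u = col v) := by
  rcases u with i | i <;> rcases v with j | j <;>
    simp [graphA, side, col, SimpleGraph.fromRel_adj, Fin.ext_iff] <;> omega

variable (n : ℕ) (K : Type*) [Field K]

/-- The linear forms. -/
noncomputable def ls : List (MvPolynomial (Fin n ⊕ Fin n) K) :=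
  (List.range ((n + 1) / 2)).map (lin K fun v => col v / 2)

theorem reg_graphA : Reg (edgeIdeal K (graphA n)) (ls n K) := by
  rw [← JJ_univ]
  refine reg_main K (graphA n) col side n graphA_adj ?_ ?_ ?_ n Set.univ 0 true (by omega)
    ⟨by simp, by simp, by simp, by simp⟩
  · rintro (i | i) (j | j) <;> simp [col, side, Fin.ext_iff]
  · rintro c hc (b | b)
    · exact ⟨.inr ⟨c, hc⟩, rfl, rfl⟩
    · exact ⟨.inl ⟨c, hc⟩, rfl, rfl⟩
  · rintro (i | i) <;> exact i.2

/-- The final quotient ideal. -/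
noncomputable def QQ : Ideal (MvPolynomial (Fin n ⊕ Fin n) K) :=
  edgeIdeal K (graphA n) ⊔ Ideal.ofList (ls n K)

/-- Vertices of the first kind in each block. -/
def par {n : ℕ} (v : Fin n ⊕ Fin n) : Prop := (side v = true ↔ col v % 2 = 0)

instance {n : ℕ} (v : Fin n ⊕ Fin n) : Decidable (par v) := by unfold par; infer_instance

/-- The factors of the socle element. -/
noncomputable def fac (j : ℕ) : MvPolynomial (Fin n ⊕ Fin n) K :=
  ∑ v with (col v / 2 = j ∧ par v), X v

/-- The socle element. -/
noncomputable def soc : MvPolynomial (Fin n ⊕ Fin n) K :=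
  ∏ j ∈ Finset.range ((n + 1) / 2), fac n K j

theorem adj_of_par {n : ℕ} (u v : Fin n ⊕ Fin n) (h : col u / 2 = col v / 2) (hu : par u)
    (hv : ¬ par v) : (graphA n).Adj u v := by
  rw [graphA_adj]
  unfold par at hu hv
  revert hu hv
  cases side u <;> cases side v <;> simp <;> omega

theorem X_mul_fac (v : Fin n ⊕ Fin n) : X v * fac n K (col v / 2) ∈ QQ n K := by
  have hedge : ∀ i j, (graphA n).Adj i j → X i * X j ∈ QQ n K := fun i j h =>
    Ideal.mem_sup_left (Ideal.subset_span ⟨i, j, h, rfl⟩)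
  by_cases hv : par v
  · have hc : (col v) < n := by rcases v with i | i <;> exact i.2
    have hl : lin K (fun v => col v / 2) (col v / 2) ∈ QQ n K := by
      refine Ideal.mem_sup_right (Ideal.subset_span ?_)
      exact List.mem_map.2 ⟨_, List.mem_range.2 (by omega), rfl⟩
    have hsplit : lin K (fun v => col v / 2) (col v / 2) = fac n K (col v / 2) +
        ∑ u with (col u / 2 = col v / 2 ∧ ¬ par u), X u := by
      unfold lin fac
      rw [← Finset.sum_filter_add_sum_filter_not _ par, Finset.filter_filter, Finset.filter_filter]
    have : X v * fac n K (col v / 2) = X v * lin K (fun v => col v / 2) (col v / 2) -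
        ∑ u with (col u / 2 = col v / 2 ∧ ¬ par u), X v * X u := by
      rw [hsplit, ← Finset.mul_sum]; ring
    rw [this]
    refine Ideal.sub_mem _ (Ideal.mul_mem_left _ _ hl) (Ideal.sum_mem _ fun u hu => ?_)
    rw [Finset.mem_filter] at hu
    exact hedge _ _ (adj_of_par v u hu.2.1.symm hv hu.2.2)
  · unfold fac
    rw [Finset.mul_sum]
    refine Ideal.sum_mem _ fun u hu => ?_
    rw [Finset.mem_filter] at hu
    exact hedge _ _ (adj_of_par u v hu.2.1 hu.2.2 hv).symm

theorem mul_soc (r : MvPolynomial (Fin n ⊕ Fin n) K) (hr : r ∈ maxIdeal K (Fin n ⊕ Fin n)) :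
    r * soc n K ∈ QQ n K := by
  refine Submodule.span_induction ?_ ?_ ?_ ?_ hr
  · rintro _ ⟨v, rfl⟩
    have hc : (col v) < n := by rcases v with i | i <;> exact i.2
    have hm : col v / 2 ∈ Finset.range ((n + 1) / 2) := Finset.mem_range.2 (by omega)
    unfold soc
    rw [← Finset.mul_prod_erase _ _ hm, ← mul_assoc]
    exact Ideal.mul_mem_right _ _ (X_mul_fac n K v)
  · simp
  · intro x y _ _ hx hy
    rw [add_mul]; exact Ideal.add_mem _ hx hy
  · intro a x _ hx
    rw [smul_eq_mul, mul_assoc]; exact Ideal.mul_mem_left _ _ hx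

theorem soc_not_mem : soc n K ∉ QQ n K := by
  classical
  let T : Ideal (MvPolynomial ℕ K) :=
    Ideal.span ((fun m => monomial m (1 : K)) '' {m | ∃ j, m = Finsupp.single j 2})
  have hT : ∀ j, (X j * X j : MvPolynomial ℕ K) ∈ T := by
    intro j
    refine Ideal.subset_span ⟨_, ⟨j, rfl⟩, ?_⟩
    simp only [X, monomial_mul, ← Finsupp.single_add]
    norm_num
  let val : Fin n ⊕ Fin n → MvPolynomial ℕ K := fun v =>
    match v with
    | .inl i => if (i : ℕ) % 2 = 0 then X ((i : ℕ) / 2) else 0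
    | .inr i => if (i : ℕ) % 2 = 0 then - X ((i : ℕ) / 2) else 0
  let θ : MvPolynomial (Fin n ⊕ Fin n) K →ₐ[K] MvPolynomial ℕ K := aeval val
  have θX : ∀ v, θ (X v) = val v := fun v => by simp [θ]
  have hQ : QQ n K ≤ T.comap θ := by
    unfold QQ
    refine sup_le ?_ ?_
    · unfold edgeIdeal
      rw [Ideal.span_le]
      rintro _ ⟨u, v, huv, rfl⟩
      rw [graphA_adj] at huv
      simp only [SetLike.mem_coe, Ideal.mem_comap, map_mul, θX]
      rcases u with i | i <;> rcases v with j | j <;> simp [side, col] at huv <;> simp only [val]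
      · by_cases h : (i : ℕ) % 2 = 0
        · rw [if_neg (show ¬ (j : ℕ) % 2 = 0 by omega)]; simp
        · rw [if_neg h]; simp
      · rw [huv]
        split_ifs
        · have := T.neg_mem (hT ((j : ℕ) / 2))
          convert this using 1
          ring
        · simp
      · rw [huv]
        split_ifs
        · have := T.neg_mem (hT ((j : ℕ) / 2))
          convert this using 1
          ring
        · simp
      · by_cases h : (i : ℕ) % 2 = 0
        · rw [if_neg (show ¬ (j : ℕ) % 2 = 0 by omega)]; simp
        · rw [if_neg h]; simp
    · unfold Ideal.ofList
      rw [Ideal.span_le]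
      intro f hf
      obtain ⟨j, -, rfl⟩ := List.mem_map.1 hf
      simp only [SetLike.mem_coe, Ideal.mem_comap]
      have : θ (lin K (fun v => col v / 2) j) = 0 := by
        unfold lin
        rw [Finset.sum_filter, Fintype.sum_sum_type, map_add, map_sum, map_sum,
          ← Finset.sum_add_distrib]
        refine Finset.sum_eq_zero fun i _ => ?_
        simp only [col]
        by_cases h : (i : ℕ) / 2 = j
        · simp only [h, if_true, θX, val]
          split_ifs <;> simp
        · simp only [h, if_false]; simp
      rw [this]; exact T.zero_mem
  intro hs
  have h1 : θ (soc n K) ∈ T := hQ hs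
  have h2 : ∀ j ∈ Finset.range ((n + 1) / 2), θ (fac n K j) = X j := by
    intro j hj
    rw [Finset.mem_range] at hj
    have h2j : 2 * j < n := by omega
    unfold fac
    rw [map_sum, Finset.sum_eq_single (Sum.inl ⟨2 * j, h2j⟩)]
    · rw [θX]
      simp only [val]
      rw [if_pos (by omega)]
      congr 1; omega
    · intro v hv hne
      rw [Finset.mem_filter] at hv
      obtain ⟨-, hv1, hv2⟩ := hv
      rw [θX]
      unfold par at hv2
      rcases v with i | i
      · simp only [col, side] at hv1 hv2
        exfalso
        apply hne
        congr 1
        apply Fin.ext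
        have := hv2.1 trivial
        simp only
        omega
      · simp only [col, side] at hv1 hv2
        simp only [val]
        rw [if_neg]
        intro h
        exact absurd (hv2.2 h) (by simp)
    · intro h
      exact absurd (Finset.mem_filter.2 ⟨Finset.mem_univ _,
        (show 2 * j / 2 = j by omega), (show (true = true ↔ 2 * j % 2 = 0) by simp)⟩) h
  have h3 : θ (soc n K) =
      monomial (∑ j ∈ Finset.range ((n + 1) / 2), Finsupp.single j 1) (1 : K) := by
    unfold soc
    rw [map_prod, Finset.prod_congr rfl h2, monomial_sum_one]
    rfl
  rw [h3] at h1
  rw [mem_ideal_span_monomial_image] at h1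
  obtain ⟨s, ⟨j, rfl⟩, hle⟩ := h1 _ (by rw [mem_support_iff, coeff_monomial, if_pos rfl]; exact one_ne_zero)
  have := hle j
  simp only [Finsupp.single_eq_same, Finsupp.coe_finsetSum, Finset.sum_apply,
    Finsupp.single_apply, Finset.sum_ite_eq'] at this
  split_ifs at this <;> omega

open CategoryTheory Abelian in
theorem depth_eq : depthQuot (edgeIdeal K (graphA n)) = (n + 1) / 2 := by
  have hlen : (ls n K).length = (n + 1) / 2 := by simp [ls]
  have hlm : ∀ r ∈ ls n K, r ∈ maxIdeal K (Fin n ⊕ Fin n) := by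
    intro r hr
    obtain ⟨j, -, rfl⟩ := List.mem_map.1 hr
    exact Ideal.sum_mem _ fun v _ => Ideal.subset_span ⟨v, rfl⟩
  have hQ : QQ n K ≠ ⊤ := fun h => soc_not_mem n K (by rw [h]; trivial)
  unfold depthQuot
  refine IsGreatest.csSup_eq ⟨⟨ls n K, hlen, hlm, (reg_graphA n K).isRegular _ _ hQ⟩, ?_⟩
  rintro k ⟨rs, rfl, hmem, hreg⟩
  by_contra hlt
  push Not at hlt
  have hmax : ∀ f ∈ maxIdeal K (Fin n ⊕ Fin n), constantCoeff f = 0 := by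
    intro f hf
    have : maxIdeal K (Fin n ⊕ Fin n) ≤ RingHom.ker (constantCoeff) := by
      unfold maxIdeal
      rw [Ideal.span_le]
      rintro _ ⟨v, rfl⟩
      simp
    exact this hf
  have hIm : edgeIdeal K (graphA n) ≤ maxIdeal K (Fin n ⊕ Fin n) := by
    unfold edgeIdeal
    rw [Ideal.span_le]
    rintro _ ⟨u, v, -, rfl⟩
    exact Ideal.mul_mem_right _ _ (Ideal.subset_span ⟨u, rfl⟩)
  have smul_lt : maxIdeal K (Fin n ⊕ Fin n) •
      (⊤ : Submodule (MvPolynomial (Fin n ⊕ Fin n) K) (MvPolynomial (Fin n ⊕ Fin n) K ⧸ edgeIdeal K (graphA n))) < ⊤ := by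
    rw [lt_top_iff_ne_top]
    intro h
    have h1 : (Submodule.mkQ (edgeIdeal K (graphA n)) 1) ∈ maxIdeal K (Fin n ⊕ Fin n) •
      (⊤ : Submodule (MvPolynomial (Fin n ⊕ Fin n) K) (MvPolynomial (Fin n ⊕ Fin n) K ⧸ edgeIdeal K (graphA n))) := by
      rw [h]; trivial
    have h2 : ∀ x ∈ maxIdeal K (Fin n ⊕ Fin n) •
      (⊤ : Submodule (MvPolynomial (Fin n ⊕ Fin n) K) (MvPolynomial (Fin n ⊕ Fin n) K ⧸ edgeIdeal K (graphA n))),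
      x ∈ Submodule.map (Submodule.mkQ (edgeIdeal K (graphA n))) (maxIdeal K (Fin n ⊕ Fin n)) := by
      suffices h : maxIdeal K (Fin n ⊕ Fin n) •
        (⊤ : Submodule (MvPolynomial (Fin n ⊕ Fin n) K) (MvPolynomial (Fin n ⊕ Fin n) K ⧸ edgeIdeal K (graphA n))) ≤ _ from h
      rw [Submodule.smul_le]
      intro r hr y _
      obtain ⟨y, rfl⟩ := Submodule.mkQ_surjective _ y
      exact ⟨r * y, Ideal.mul_mem_right _ _ hr, by simp [← smul_eq_mul]⟩
    obtain ⟨y, hy, hy1⟩ := h2 _ h1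
    have h3 : y - 1 ∈ edgeIdeal K (graphA n) := by
      exact (Submodule.Quotient.eq (edgeIdeal K (graphA n))).1 hy1
    have h4 : (1 : MvPolynomial (Fin n ⊕ Fin n) K) ∈ maxIdeal K (Fin n ⊕ Fin n) := by
      have := Ideal.sub_mem _ hy (hIm h3)
      simpa using this
    have := hmax _ h4
    simp at this
  let N := ModuleCat.of (MvPolynomial (Fin n ⊕ Fin n) K)
    (MvPolynomial (Fin n ⊕ Fin n) K ⧸ maxIdeal K (Fin n ⊕ Fin n))
  have hN : Module.Finite (MvPolynomial (Fin n ⊕ Fin n) K) N :=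
    inferInstanceAs (Module.Finite _
      (MvPolynomial (Fin n ⊕ Fin n) K ⧸ maxIdeal K (Fin n ⊕ Fin n)))
  have hsupp : Module.support (MvPolynomial (Fin n ⊕ Fin n) K) N ⊆
      PrimeSpectrum.zeroLocus (maxIdeal K (Fin n ⊕ Fin n)) := by
    rw [Module.support_eq_zeroLocus]
    have hann : Module.annihilator (MvPolynomial (Fin n ⊕ Fin n) K) N =
        maxIdeal K (Fin n ⊕ Fin n) := Ideal.annihilator_quotient
    rw [hann]
  have hext := ModuleCat.subsingleton_ext_of_exists_isRegular (maxIdeal K (Fin n ⊕ Fin n)) N hsupp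
    (ModuleCat.of _ (MvPolynomial (Fin n ⊕ Fin n) K ⧸ edgeIdeal K (graphA n))) smul_lt rs hmem hreg
  have h0 : Subsingleton (Ext N (ModuleCat.of (MvPolynomial (Fin n ⊕ Fin n) K)
      (MvPolynomial (Fin n ⊕ Fin n) K ⧸ QQ n K)) 0) := Reg.ext_quot N (ls n K) (edgeIdeal K (graphA n)) 1 (reg_graphA n K)
    (fun i hi => hext i (by omega)) 0 (by omega)
  have h5 : Subsingleton
    ((MvPolynomial (Fin n ⊕ Fin n) K ⧸ maxIdeal K (Fin n ⊕ Fin n)) →ₗ[MvPolynomial (Fin n ⊕ Fin n) K]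
      (MvPolynomial (Fin n ⊕ Fin n) K ⧸ QQ n K)) :=
    (Ext.addEquiv₀.trans (ModuleCat.homAddEquiv (M := N)
      (N := ModuleCat.of (MvPolynomial (Fin n ⊕ Fin n) K)
        (MvPolynomial (Fin n ⊕ Fin n) K ⧸ QQ n K)))).symm.subsingleton
  let g : (MvPolynomial (Fin n ⊕ Fin n) K ⧸ maxIdeal K (Fin n ⊕ Fin n))
      →ₗ[MvPolynomial (Fin n ⊕ Fin n) K] (MvPolynomial (Fin n ⊕ Fin n) K ⧸ QQ n K) :=
    Submodule.liftQ _ (LinearMap.toSpanSingleton _ _ (Submodule.mkQ (QQ n K) (soc n K))) (by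
      intro r hr
      rw [LinearMap.mem_ker, LinearMap.toSpanSingleton_apply, ← map_smul]
      exact Ideal.Quotient.eq_zero_iff_mem.2 (mul_soc n K r hr))
  have hg : g = 0 := Subsingleton.elim _ _
  have hg1 : g (Submodule.mkQ _ 1) = 0 := by rw [hg]; rfl
  have hg2 : g (Submodule.mkQ _ 1) = Submodule.mkQ (QQ n K) (soc n K) := by
    change LinearMap.toSpanSingleton (MvPolynomial (Fin n ⊕ Fin n) K) _ (Submodule.mkQ (QQ n K) (soc n K)) 1 = _
    rw [LinearMap.toSpanSingleton_apply, one_smul]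
  rw [hg2] at hg1
  exact soc_not_mem n K (Ideal.Quotient.eq_zero_iff_mem.1 hg1)

end Concrete

end LadderDepth

theorem depth_graphA (n : ℕ) (hn : 2 ≤ n) (K : Type*) [Field K] :
    depthQuot (edgeIdeal K (graphA n)) = 2 * n - ⌊3 * (n : ℚ) / 2⌋₊ ∧
    depthQuot (edgeIdeal K (graphA n)) = ⌈(n : ℚ) / 2⌉₊ := by

  have h := LadderDepth.depth_eq n K
  rw [h]
  have h1 : ⌊3 * (n : ℚ) / 2⌋₊ = 3 * n / 2 := by
    have := Nat.floor_div_eq_div (K := ℚ) (3 * n) 2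
    push_cast at this
    exact this
  have h2 : ⌈(n : ℚ) / 2⌉₊ = (n + 1) / 2 := by
    obtain ⟨k, hk⟩ := Nat.even_or_odd' n
    have hpos : 0 < (n + 1) / 2 := by omega
    rw [Nat.ceil_eq_iff hpos.ne']
    rcases hk with rfl | rfl
    · have : (2 * k + 1) / 2 = k := by omega
      rw [this]
      have hk : 1 ≤ k := by omega
      push_cast [Nat.cast_sub hk]
      constructor <;> linarith
    · have : (2 * k + 1 + 1) / 2 = k + 1 := by omega
      rw [this]
      push_cast [Nat.add_sub_cancel]
      constructor <;> linarith
  rw [h1, h2]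
  omega
end
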